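/- Let f ∈ Λ_p, 1<p<∞, 0<α₁<β₁, 0<α₂<β₂, δ₁,δ₂ ∈ (0,1/2). Then ω_{α₁,α₂}(f,δ₁,δ₂)_p ≍ δ₁^{α₁} δ₂^{α₂} {∫_{δ₁}¹∫_{δ₂}¹ [t₁^{−α₁} t₂^{−α₂} ω_{β₁,β₂}(f,t₁,t₂)_p]² (dt₁/t₁)(dt₂/t₂)}^{1/2}, with constants independent of f, δ₁, δ₂. -/

import Mathlib

open MeasureTheory Real
open scoped ENNReal

noncomputable section

/-- The `L_p` norm of a function of two variables over the period square `(0,2π]²`. -/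
def Lp2Norm (p : ℝ) (f : ℝ → ℝ → ℝ) : ℝ≥0∞ :=
  (∫⁻ x in Set.Ioc (0:ℝ) (2*π), ∫⁻ y in Set.Ioc (0:ℝ) (2*π),
      ENNReal.ofReal (|f x y| ^ p)) ^ (1/p)

/-- `f ∈ L_p^0(T²)`: measurable, `2π`-periodic in each variable, finite `L_p` norm,
and zero mean in each variable separately. -/
structure MemLp0 (p : ℝ) (f : ℝ → ℝ → ℝ) : Prop where
  meas : Measurable (Function.uncurry f)
  periodic_x : ∀ y, Function.Periodic (fun x => f x y) (2*π)
  periodic_y : ∀ x, Function.Periodic (f x) (2*π)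
  norm_ne_top : Lp2Norm p f ≠ ⊤
  mean_x : ∀ᵐ (y : ℝ) ∂volume, (∫ x in (0:ℝ)..(2*π), f x y) = 0
  mean_y : ∀ᵐ (x : ℝ) ∂volume, (∫ y in (0:ℝ)..(2*π), f x y) = 0

/-- Generalized (fractional) binomial coefficient `C(α,ν) = α(α-1)⋯(α-ν+1)/ν!`. -/
def fracBinom (α : ℝ) : ℕ → ℝ
  | 0 => 1
  | n+1 => fracBinom α n * (α - (n : ℝ)) / ((n : ℝ) + 1)

/-- Fractional difference of order `α` with step `h` in the first variable. -/
def diffX (α h : ℝ) (f : ℝ → ℝ → ℝ) : ℝ → ℝ → ℝ :=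
  fun x y => ∑' ν : ℕ, (-1 : ℝ) ^ ν * fracBinom α ν * f (x + (α - (ν : ℝ)) * h) y

/-- Fractional difference of order `α` with step `h` in the second variable. -/
def diffY (α h : ℝ) (f : ℝ → ℝ → ℝ) : ℝ → ℝ → ℝ :=
  fun x y => ∑' ν : ℕ, (-1 : ℝ) ^ ν * fracBinom α ν * f x (y + (α - (ν : ℝ)) * h)

/-- The mixed (fractional) modulus of smoothness `ω_{α₁,α₂}(f, δ₁, δ₂)_p`. -/
def mixedMod (p α₁ α₂ δ₁ δ₂ : ℝ) (f : ℝ → ℝ → ℝ) : ℝ≥0∞ :=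
  ⨆ (h₁ : ℝ) (_ : |h₁| ≤ δ₁) (h₂ : ℝ) (_ : |h₂| ≤ δ₂),
    Lp2Norm p (diffX α₁ h₁ (diffY α₂ h₂ f))

/-- `δ₁^{α₁} δ₂^{α₂} {∫_{δ₁}^1 ∫_{δ₂}^1 [t₁^{-α₁} t₂^{-α₂} ω_{β₁,β₂}(f,t₁,t₂)_p]^s (dt₁/t₁)(dt₂/t₂)}^{1/s}`. -/
def marchaudInt (p α₁ α₂ β₁ β₂ δ₁ δ₂ s : ℝ) (f : ℝ → ℝ → ℝ) : ℝ≥0∞ :=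
  ENNReal.ofReal (δ₁ ^ α₁ * δ₂ ^ α₂) *
    (∫⁻ t₁ in Set.Ioo δ₁ 1, ∫⁻ t₂ in Set.Ioo δ₂ 1,
      ENNReal.ofReal ((t₁ ^ (-α₁) * t₂ ^ (-α₂)) ^ s / (t₁ * t₂)) *
        mixedMod p β₁ β₂ t₁ t₂ f ^ s) ^ (1/s)

/-- Cosine-cosine Fourier coefficient `a_{n₁,n₂}` of `f`. -/
def fourierCC (f : ℝ → ℝ → ℝ) (n₁ n₂ : ℕ) : ℝ :=
  (1/π^2) * ∫ x in (0:ℝ)..(2*π), ∫ y in (0:ℝ)..(2*π),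
    f x y * Real.cos ((n₁ : ℝ) * x) * Real.cos ((n₂ : ℝ) * y)

/-- Sine-cosine Fourier coefficient `b_{n₁,n₂}` of `f`. -/
def fourierSC (f : ℝ → ℝ → ℝ) (n₁ n₂ : ℕ) : ℝ :=
  (1/π^2) * ∫ x in (0:ℝ)..(2*π), ∫ y in (0:ℝ)..(2*π),
    f x y * Real.sin ((n₁ : ℝ) * x) * Real.cos ((n₂ : ℝ) * y)

/-- Cosine-sine Fourier coefficient `c_{n₁,n₂}` of `f`. -/
def fourierCS (f : ℝ → ℝ → ℝ) (n₁ n₂ : ℕ) : ℝ :=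
  (1/π^2) * ∫ x in (0:ℝ)..(2*π), ∫ y in (0:ℝ)..(2*π),
    f x y * Real.cos ((n₁ : ℝ) * x) * Real.sin ((n₂ : ℝ) * y)

/-- Sine-sine Fourier coefficient `d_{n₁,n₂}` of `f`. -/
def fourierSS (f : ℝ → ℝ → ℝ) (n₁ n₂ : ℕ) : ℝ :=
  (1/π^2) * ∫ x in (0:ℝ)..(2*π), ∫ y in (0:ℝ)..(2*π),
    f x y * Real.sin ((n₁ : ℝ) * x) * Real.sin ((n₂ : ℝ) * y)

/-- The class `Λ_p`: `f ∈ L_p^0(T²)` with lacunary Fourier series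
`Σ λ_{μ₁,μ₂} cos 2^{μ₁}x cos 2^{μ₂}y`. -/
def InLambdaClass (p : ℝ) (f : ℝ → ℝ → ℝ) (lam : ℕ → ℕ → ℝ) : Prop :=
  MemLp0 p f ∧
  (∀ μ₁ μ₂ : ℕ, fourierCC f (2^μ₁) (2^μ₂) = lam μ₁ μ₂) ∧
  (∀ n₁ n₂ : ℕ, (¬ ∃ μ₁ μ₂ : ℕ, n₁ = 2^μ₁ ∧ n₂ = 2^μ₂) → fourierCC f n₁ n₂ = 0) ∧
  (∀ n₁ n₂ : ℕ, fourierSC f n₁ n₂ = 0 ∧ fourierCS f n₁ n₂ = 0 ∧ fourierSS f n₁ n₂ = 0)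

theorem fracBinom_succ_mul (α : ℝ) (n : ℕ) :
    fracBinom α (n + 1) * ((n : ℝ) + 1) = fracBinom α n * (α - n) := by
  rw [fracBinom]
  field_simp

theorem summable_abs_fracBinom {α : ℝ} (hα : 0 < α) : Summable fun ν => |fracBinom α ν| := by
  obtain ⟨N, hN⟩ := exists_nat_ge α
  rw [← summable_nat_add_iff N]
  have key : ∀ M : ℕ, α * ∑ i ∈ Finset.range M, |fracBinom α (i + N)| =
      N * |fracBinom α N| - ((M + N : ℕ) : ℝ) * |fracBinom α (M + N)| := by
    intro M
    induction M with
    | zero => simp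
    | succ M ih =>
      have h := congrArg abs (fracBinom_succ_mul α (M + N))
      have hle : α ≤ ((M + N : ℕ) : ℝ) := by
        push_cast
        have : (0 : ℝ) ≤ M := M.cast_nonneg
        linarith
      rw [abs_mul, abs_mul, abs_of_nonneg (by positivity : (0 : ℝ) ≤ ((M + N : ℕ) : ℝ) + 1),
        abs_of_nonpos (by linarith : α - ((M + N : ℕ) : ℝ) ≤ 0)] at h
      rw [Finset.sum_range_succ, mul_add, ih]
      have e : M + 1 + N = M + N + 1 := by ring
      rw [e]
      push_cast at h ⊢
      linarith
  refine summable_of_sum_range_le (c := N * |fracBinom α N| / α) (fun _ => abs_nonneg _) ?_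
  intro M
  rw [le_div_iff₀ hα, mul_comm, key]
  have : 0 ≤ ((M + N : ℕ) : ℝ) * |fracBinom α (M + N)| := by positivity
  linarith

theorem fracBinom_eq_choose (α : ℝ) (n : ℕ) : (fracBinom α n : ℂ) = Ring.choose (α : ℂ) n := by
  induction n with
  | zero => simp [fracBinom]
  | succ n ih =>
    have h : Ring.choose (α : ℂ) (n + 1) = Ring.choose (α : ℂ) n * (α - n) / (n + 1) := by
      rw [Ring.choose_eq_smul, Ring.choose_eq_smul, descPochhammer_succ_right,
        Polynomial.smeval_mul, Polynomial.smeval_sub, Polynomial.smeval_X,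
        Polynomial.smeval_natCast]
      rw [Nat.factorial_succ]
      have h1 : ((n : ℂ) + 1) ≠ 0 := by exact_mod_cast Nat.succ_ne_zero n
      have h2 : (n.factorial : ℂ) ≠ 0 := by exact_mod_cast n.factorial_ne_zero
      push_cast
      simp only [smul_eq_mul, pow_one, pow_zero, nsmul_eq_mul, mul_one]
      field_simp
    rw [h, ← ih, fracBinom]
    push_cast
    ring

/-- Signed coefficients of the binomial series of `(1 - z) ^ α`. -/
def diffCoeff (α : ℝ) (ν : ℕ) : ℝ := (-1 : ℝ) ^ ν * fracBinom α ν

theorem summable_abs_diffCoeff {α : ℝ} (hα : 0 < α) : Summable fun ν => |diffCoeff α ν| := by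
  simpa [diffCoeff, abs_mul] using summable_abs_fracBinom hα

theorem tsum_diffCoeff_mul_pow_of_norm_lt_one (α : ℝ) {z : ℂ} (hz : ‖z‖ < 1) :
    ∑' ν, (diffCoeff α ν : ℂ) * z ^ ν = (1 - z) ^ (α : ℂ) := by
  have h := Complex.one_add_cpow_hasFPowerSeriesOnBall_zero (a := (α : ℂ))
  have h2 := h.hasSum (y := -z) (by simpa [← ofReal_norm] using hz)
  rw [zero_add, ← sub_eq_add_neg] at h2
  rw [← h2.tsum_eq]
  refine tsum_congr fun n => ?_
  rw [binomialSeries_apply]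
  simp [diffCoeff, fracBinom_eq_choose, neg_pow z n]
  ring

theorem norm_tsum_diffCoeff_mul_pow {α : ℝ} (hα : 0 < α) {z : ℂ} (hz : ‖z‖ = 1) :
    ‖∑' ν, (diffCoeff α ν : ℂ) * z ^ ν‖ = ‖1 - z‖ ^ α := by
  have h1 : Filter.Tendsto (fun r : ℝ => ∑' ν, (diffCoeff α ν : ℂ) * ((r : ℂ) * z) ^ ν)
      (nhdsWithin 1 (Set.Ioo 0 1)) (nhds (∑' ν, (diffCoeff α ν : ℂ) * ((1 : ℂ) * z) ^ ν)) := by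
    refine tendsto_tsum_of_dominated_convergence (summable_abs_diffCoeff hα) ?_ ?_
    · intro k
      have : Continuous fun r : ℝ => (diffCoeff α k : ℂ) * ((r : ℂ) * z) ^ k := by fun_prop
      simpa using (this.tendsto 1).mono_left nhdsWithin_le_nhds
    · filter_upwards [self_mem_nhdsWithin] with r hr k
      rw [norm_mul, norm_pow, norm_mul, hz, Complex.norm_real, Complex.norm_real, mul_one,
        Real.norm_eq_abs, Real.norm_eq_abs, abs_of_pos hr.1]
      exact mul_le_of_le_one_right (abs_nonneg _) (pow_le_one₀ hr.1.le hr.2.le)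
  have h2 : Filter.Tendsto (fun r : ℝ => ‖1 - (r : ℂ) * z‖ ^ α)
      (nhdsWithin 1 (Set.Ioo 0 1)) (nhds (‖1 - ((1 : ℝ) : ℂ) * z‖ ^ α)) := by
    have : Continuous fun r : ℝ => ‖1 - (r : ℂ) * z‖ ^ α :=
      Continuous.rpow_const (by fun_prop) fun _ => Or.inr hα.le
    exact (this.tendsto 1).mono_left nhdsWithin_le_nhds
  have : (nhdsWithin (1 : ℝ) (Set.Ioo 0 1)).NeBot := by
    rw [nhdsWithin_Ioo_eq_nhdsLT (by norm_num)]
    infer_instance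
  have h3 : Filter.Tendsto (fun r : ℝ => ‖∑' ν, (diffCoeff α ν : ℂ) * ((r : ℂ) * z) ^ ν‖)
      (nhdsWithin 1 (Set.Ioo 0 1)) (nhds (‖1 - ((1 : ℝ) : ℂ) * z‖ ^ α)) := by
    refine h2.congr' ?_
    filter_upwards [self_mem_nhdsWithin] with r hr
    rw [tsum_diffCoeff_mul_pow_of_norm_lt_one, Complex.norm_cpow_real]
    rw [norm_mul, hz, Complex.norm_real, mul_one, Real.norm_eq_abs, abs_of_pos hr.1]
    exact hr.2
  simpa using tendsto_nhds_unique h1.norm h3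

/-- The Fourier multiplier of the difference of order `α` and step `h`. -/
def diffMult (α h : ℝ) (n : ℤ) : ℂ :=
  ∑' ν : ℕ, (diffCoeff α ν : ℂ) * Complex.exp (Complex.I * (n * ((α - ν) * h)))

theorem norm_one_sub_exp_neg (t : ℝ) :
    ‖1 - Complex.exp (-(Complex.I * t))‖ = |2 * Real.sin (t / 2)| := by
  rw [norm_sub_rev]
  have := Complex.norm_exp_I_mul_ofReal_sub_one (-t)
  rw [show Complex.I * ((-t : ℝ) : ℂ) = -(Complex.I * t) by push_cast; ring] at this
  rw [this, Real.norm_eq_abs, neg_div, Real.sin_neg, mul_neg, abs_neg]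

theorem norm_diffMult {α : ℝ} (hα : 0 < α) (h : ℝ) (n : ℤ) :
    ‖diffMult α h n‖ = |2 * Real.sin (n * h / 2)| ^ α := by
  have e : diffMult α h n = Complex.exp (((n * α * h : ℝ) : ℂ) * Complex.I) *
      ∑' ν, (diffCoeff α ν : ℂ) * (Complex.exp (-(Complex.I * ((n * h : ℝ) : ℂ)))) ^ ν := by
    rw [diffMult, ← tsum_mul_left]
    refine tsum_congr fun ν => ?_
    rw [← Complex.exp_nat_mul, mul_left_comm (Complex.exp _), ← Complex.exp_add]
    congr 2
    push_cast
    ring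
  rw [e, norm_mul, Complex.norm_exp_ofReal_mul_I, one_mul, norm_tsum_diffCoeff_mul_pow hα,
    norm_one_sub_exp_neg]
  rw [show -(Complex.I * ((n * h : ℝ) : ℂ)) = ((-(n * h) : ℝ) : ℂ) * Complex.I by push_cast; ring]
  exact Complex.norm_exp_ofReal_mul_I _

theorem norm_diffMult_eq_of_natAbs {α : ℝ} (hα : 0 < α) (h : ℝ) {n : ℤ} {μ : ℕ}
    (hn : n.natAbs = 2 ^ μ) :
    ‖diffMult α h n‖ = |2 * Real.sin (2 ^ μ * h / 2)| ^ α := by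
  rw [norm_diffMult hα]
  rcases Int.natAbs_eq n with h1 | h1 <;> rw [h1, hn] <;> push_cast
  · rfl
  · rw [neg_mul, neg_div, Real.sin_neg, mul_neg, abs_neg]

/-- The number of ordered representations of an integer as a sum of `k` powers of two is
bounded in terms of `k`. -/
theorem exists_card_sum_two_pow_le (k : ℕ) :
    ∃ R : ℕ, ∀ (n : ℕ) (A : Finset (Fin k → ℕ)), (∀ t ∈ A, ∑ i, 2 ^ t i = n) → A.card ≤ R := by
  induction k with
  | zero => exact ⟨1, fun n A _ => Finset.card_le_one_of_subsingleton A⟩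
  | succ k ih =>
    obtain ⟨R, hR⟩ := ih
    refine ⟨R * ((k + 1) * (k + 2)), fun n A hA => ?_⟩
    have hmax : ∀ t ∈ A, ∃ i : Fin (k + 1),
        t i ∈ Finset.Icc (Nat.log 2 n - (k + 1)) (Nat.log 2 n) := by
      intro t ht
      obtain ⟨i, -, hi⟩ := Finset.exists_max_image Finset.univ t Finset.univ_nonempty
      refine ⟨i, Finset.mem_Icc.2 ⟨?_, ?_⟩⟩
      · have hn : n ≠ 0 := by
          rw [← hA t ht]
          exact (Finset.sum_pos (fun _ _ => by positivity) Finset.univ_nonempty).ne'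
        have h1 : n ≤ (k + 1) * 2 ^ t i := by
          rw [← hA t ht]
          refine (Finset.sum_le_card_nsmul _ _ (2 ^ t i) fun j _ => ?_).trans (by simp)
          exact Nat.pow_le_pow_right (by norm_num) (hi j (Finset.mem_univ _))
        have h2 : 2 ^ Nat.log 2 n ≤ n := Nat.pow_log_le_self 2 hn
        have h3 : k + 1 < 2 ^ (k + 1) := Nat.lt_two_pow_self
        have h4 : 2 ^ Nat.log 2 n < 2 ^ (k + 1 + t i) := by
          rw [pow_add]
          exact (h2.trans h1).trans_lt (Nat.mul_lt_mul_of_pos_right h3 (by positivity))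
        have := (Nat.pow_lt_pow_iff_right (by norm_num)).1 h4
        omega
      · refine Nat.le_log_of_pow_le (by norm_num) ?_
        rw [← hA t ht]
        exact Finset.single_le_sum (f := fun i => 2 ^ t i) (fun _ _ => Nat.zero_le _)
          (Finset.mem_univ i)
    choose! I hI using hmax
    have hmaps : ∀ t ∈ A, (I t, t (I t)) ∈
        (Finset.univ : Finset (Fin (k + 1))) ×ˢ Finset.Icc (Nat.log 2 n - (k + 1)) (Nat.log 2 n) :=
      fun t ht => Finset.mem_product.2 ⟨Finset.mem_univ _, hI t ht⟩
    refine (Finset.card_le_mul_card_image_of_maps_to hmaps R ?_).trans ?_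
    · rintro ⟨i, v⟩ -
      set B := A.filter fun t => (I t, t (I t)) = (i, v) with hB
      have hBi : ∀ t ∈ B, t ∈ A ∧ t i = v := by
        intro t ht
        obtain ⟨h1, h2⟩ := Finset.mem_filter.1 ht
        rw [Prod.mk.injEq] at h2
        exact ⟨h1, by rw [← h2.2, h2.1]⟩
      have hinj : Set.InjOn (fun t : Fin (k + 1) → ℕ => i.removeNth t) B := by
        intro s hs t ht hst
        rw [← Fin.insertNth_self_removeNth i s, ← Fin.insertNth_self_removeNth i t,
          (hBi s hs).2, (hBi t ht).2]
        exact congrArg _ hst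
      rw [← Finset.card_image_of_injOn hinj]
      refine hR (n - 2 ^ v) _ fun u hu => ?_
      obtain ⟨t, ht, rfl⟩ := Finset.mem_image.1 hu
      have := hA t (hBi t ht).1
      rw [Fin.sum_univ_succAbove _ i, (hBi t ht).2] at this
      simp only [Fin.removeNth]
      omega
    · refine Nat.mul_le_mul_left _ ?_
      rw [Finset.card_product, Finset.card_univ, Fintype.card_fin, Nat.card_Icc]
      exact Nat.mul_le_mul_left _ (by omega)

theorem exists_card_sum_two_pow_prod_le (k : ℕ) :
    ∃ R : ℕ, ∀ (m n : ℕ) (A : Finset (Fin k → ℕ × ℕ)),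
      (∀ t ∈ A, ∑ i, 2 ^ (t i).1 = m ∧ ∑ i, 2 ^ (t i).2 = n) → A.card ≤ R := by
  obtain ⟨R, hR⟩ := exists_card_sum_two_pow_le k
  refine ⟨R * R, fun m n A hA => ?_⟩
  classical
  have hinj : Function.Injective fun t : Fin k → ℕ × ℕ =>
      ((fun i => (t i).1), fun i => (t i).2) := by
    intro s t hst
    rw [Prod.mk.injEq] at hst
    funext i
    exact Prod.ext (congrFun hst.1 i) (congrFun hst.2 i)
  rw [← Finset.card_image_of_injective A hinj]
  refine (Finset.card_le_card (t := (A.image fun t i => (t i).1) ×ˢ (A.image fun t i => (t i).2))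
    ?_).trans ?_
  · intro x hx
    obtain ⟨t, ht, rfl⟩ := Finset.mem_image.1 hx
    exact Finset.mem_product.2 ⟨Finset.mem_image_of_mem _ ht, Finset.mem_image_of_mem _ ht⟩
  · rw [Finset.card_product]
    refine Nat.mul_le_mul (hR m _ ?_) (hR n _ ?_)
    · intro u hu
      obtain ⟨t, ht, rfl⟩ := Finset.mem_image.1 hu
      exact (hA t ht).1
    · intro u hu
      obtain ⟨t, ht, rfl⟩ := Finset.mem_image.1 hu
      exact (hA t ht).2

/-- Lebesgue measure on the period square. -/
def torusMeasure : Measure (ℝ × ℝ) :=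
  (volume.restrict (Set.Ioc (0 : ℝ) (2 * π))).prod (volume.restrict (Set.Ioc (0 : ℝ) (2 * π)))

instance : IsFiniteMeasure torusMeasure := by
  unfold torusMeasure
  infer_instance

/-- The exponential `exp (i (n₁ x + n₂ y))`. -/
def torusChar (n : ℤ × ℤ) (z : ℝ × ℝ) : ℂ :=
  Complex.exp (((n.1 * z.1 + n.2 * z.2 : ℝ) : ℂ) * Complex.I)

theorem continuous_torusChar (n : ℤ × ℤ) : Continuous (torusChar n) := by
  unfold torusChar
  fun_prop

theorem norm_torusChar (n : ℤ × ℤ) (z : ℝ × ℝ) : ‖torusChar n z‖ = 1 :=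
  Complex.norm_exp_ofReal_mul_I _

theorem torusChar_add (m n : ℤ × ℤ) (z : ℝ × ℝ) :
    torusChar (m + n) z = torusChar m z * torusChar n z := by
  rw [torusChar, torusChar, torusChar, ← Complex.exp_add]
  congr 1
  push_cast [Prod.fst_add, Prod.snd_add]
  ring

theorem conj_torusChar (n : ℤ × ℤ) (z : ℝ × ℝ) :
    (starRingEnd ℂ) (torusChar n z) = torusChar (-n) z := by
  rw [torusChar, torusChar, ← Complex.exp_conj]
  congr 1
  simp
  ring

theorem torusChar_sum {κ : Type*} (s : Finset κ) (m : κ → ℤ × ℤ) (z : ℝ × ℝ) :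
    torusChar (∑ i ∈ s, m i) z = ∏ i ∈ s, torusChar (m i) z := by
  classical
  induction s using Finset.induction_on with
  | empty => simp [torusChar]
  | insert a s ha ih => rw [Finset.sum_insert ha, Finset.prod_insert ha, torusChar_add, ih]

theorem torusChar_eq_mul (n : ℤ × ℤ) (z : ℝ × ℝ) :
    torusChar n z =
      Complex.exp ((n.1 * Complex.I) * z.1) * Complex.exp ((n.2 * Complex.I) * z.2) := by
  rw [torusChar, ← Complex.exp_add]
  congr 1
  push_cast
  ring

theorem integral_exp_int_mul (n : ℤ) :
    ∫ x in Set.Ioc (0 : ℝ) (2 * π), Complex.exp ((n * Complex.I) * x) =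
      if n = 0 then (2 * π : ℂ) else 0 := by
  rw [← intervalIntegral.integral_of_le (by positivity)]
  split_ifs with h
  · simp [h]
  · have hc : (n * Complex.I : ℂ) ≠ 0 := by simp [h]
    rw [integral_exp_mul_complex hc]
    have : Complex.exp (n * Complex.I * ((2 * π : ℝ) : ℂ)) = 1 := by
      rw [show (n * Complex.I * ((2 * π : ℝ) : ℂ)) = n * (2 * π * Complex.I) by push_cast; ring]
      exact Complex.exp_int_mul_two_pi_mul_I n
    rw [this]
    simp

theorem integral_torusChar (n : ℤ × ℤ) :
    ∫ z, torusChar n z ∂torusMeasure = if n = 0 then (4 * π ^ 2 : ℂ) else 0 := by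
  simp_rw [torusChar_eq_mul]
  rw [torusMeasure, integral_prod_mul (fun x : ℝ => Complex.exp ((n.1 * Complex.I) * x))
    (fun y : ℝ => Complex.exp ((n.2 * Complex.I) * y)),
    integral_exp_int_mul, integral_exp_int_mul]
  obtain ⟨a, b⟩ := n
  by_cases ha : a = 0 <;> by_cases hb : b = 0 <;> simp [ha, hb, Prod.ext_iff]
  ring

theorem integrable_torusChar (n : ℤ × ℤ) : Integrable (torusChar n) torusMeasure :=
  Integrable.of_bound (continuous_torusChar n).aestronglyMeasurable 1
    (Filter.Eventually.of_forall fun z => (norm_torusChar n z).le)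

theorem integral_norm_sq_sum_torusChar_le {κ : Type*} (T : Finset κ) (b : κ → ℂ) (φ : κ → ℤ × ℤ)
    (R : ℕ) (hR : ∀ t ∈ T, (T.filter fun s => φ s = φ t).card ≤ R) :
    ∫ z, ‖∑ t ∈ T, b t * torusChar (φ t) z‖ ^ 2 ∂torusMeasure ≤
      4 * π ^ 2 * R * ∑ t ∈ T, ‖b t‖ ^ 2 := by
  have h1 : ((∫ z, ‖∑ t ∈ T, b t * torusChar (φ t) z‖ ^ 2 ∂torusMeasure : ℝ) : ℂ) =
      ∑ s ∈ T, ∑ t ∈ T, b s * (starRingEnd ℂ) (b t) *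
        (if φ s = φ t then (4 * π ^ 2 : ℂ) else 0) := by
    rw [← integral_complex_ofReal]
    have e : ∀ z, ((‖∑ t ∈ T, b t * torusChar (φ t) z‖ ^ 2 : ℝ) : ℂ) =
        ∑ s ∈ T, ∑ t ∈ T, b s * (starRingEnd ℂ) (b t) * torusChar (φ s - φ t) z := by
      intro z
      push_cast
      rw [← Complex.mul_conj', map_sum, Finset.sum_mul_sum]
      refine Finset.sum_congr rfl fun s _ => Finset.sum_congr rfl fun t _ => ?_
      rw [map_mul, conj_torusChar, sub_eq_add_neg, torusChar_add]
      ring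
    simp_rw [e]
    rw [integral_finsetSum _ fun s _ => integrable_finsetSum _ fun t _ =>
      (integrable_torusChar _).const_mul _]
    refine Finset.sum_congr rfl fun s _ => ?_
    rw [integral_finsetSum _ fun t _ => (integrable_torusChar _).const_mul _]
    refine Finset.sum_congr rfl fun t _ => ?_
    rw [integral_const_mul, integral_torusChar]
    simp only [sub_eq_zero]
  have h2 : ∫ z, ‖∑ t ∈ T, b t * torusChar (φ t) z‖ ^ 2 ∂torusMeasure ≤
      ∑ s ∈ T, ∑ t ∈ T, if φ s = φ t then 2 * π ^ 2 * (‖b s‖ ^ 2 + ‖b t‖ ^ 2) else 0 := by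
    have h3 := congrArg Complex.re h1
    rw [Complex.ofReal_re] at h3
    rw [h3, Complex.re_sum]
    refine Finset.sum_le_sum fun s _ => ?_
    rw [Complex.re_sum]
    refine Finset.sum_le_sum fun t _ => ?_
    refine (Complex.re_le_norm _).trans ?_
    split_ifs
    · rw [norm_mul, norm_mul, RCLike.norm_conj]
      have : ‖(4 * π ^ 2 : ℂ)‖ = 4 * π ^ 2 := by
        rw [show (4 * π ^ 2 : ℂ) = ((4 * π ^ 2 : ℝ) : ℂ) by push_cast; ring, Complex.norm_real,
          Real.norm_of_nonneg (by positivity)]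
      rw [this]
      nlinarith [mul_nonneg (sq_nonneg π) (sq_nonneg (‖b s‖ - ‖b t‖))]
    · simp
  refine h2.trans ?_
  have h4 : ∀ s t, (if φ s = φ t then 2 * π ^ 2 * (‖b s‖ ^ 2 + ‖b t‖ ^ 2) else 0) =
      (if φ t = φ s then 2 * π ^ 2 * ‖b s‖ ^ 2 else 0) +
        (if φ s = φ t then 2 * π ^ 2 * ‖b t‖ ^ 2 else 0) := by
    intro s t
    by_cases h : φ s = φ t
    · rw [if_pos h, if_pos h, if_pos h.symm]
      ring
    · rw [if_neg h, if_neg h, if_neg (Ne.symm h), add_zero]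
  simp_rw [h4, Finset.sum_add_distrib]
  have h5 : ∑ s ∈ T, ∑ t ∈ T, (if φ t = φ s then 2 * π ^ 2 * ‖b s‖ ^ 2 else 0) ≤
      2 * π ^ 2 * R * ∑ t ∈ T, ‖b t‖ ^ 2 := by
    rw [Finset.mul_sum]
    refine Finset.sum_le_sum fun s hs => ?_
    rw [← Finset.sum_filter, Finset.sum_const, nsmul_eq_mul]
    have : ((T.filter fun t => φ t = φ s).card : ℝ) ≤ R := by exact_mod_cast hR s hs
    calc _ ≤ (R : ℝ) * (2 * π ^ 2 * ‖b s‖ ^ 2) := by gcongr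
      _ = _ := by ring
  have h6 : ∑ s ∈ T, ∑ t ∈ T, (if φ s = φ t then 2 * π ^ 2 * ‖b t‖ ^ 2 else 0) ≤
      2 * π ^ 2 * R * ∑ t ∈ T, ‖b t‖ ^ 2 := by
    rw [Finset.sum_comm]
    exact h5
  linarith

/-- Even-exponent estimate for double lacunary polynomials with fixed signs of frequencies. -/
theorem exists_integral_norm_pow_lacunary_le (k : ℕ) :
    ∃ D : ℝ, 0 ≤ D ∧ ∀ (ε η : ℤ), ε ≠ 0 → η ≠ 0 → ∀ (S : Finset (ℕ × ℕ)) (a : ℕ × ℕ → ℂ),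
      ∫ z, ‖∑ j ∈ S, a j * torusChar (ε * 2 ^ j.1, η * 2 ^ j.2) z‖ ^ (2 * k) ∂torusMeasure ≤
        D * (∑ j ∈ S, ‖a j‖ ^ 2) ^ k := by
  obtain ⟨R, hR⟩ := exists_card_sum_two_pow_prod_le k
  refine ⟨4 * π ^ 2 * R, by positivity, fun ε η hε hη S a => ?_⟩
  classical
  let m : ℕ × ℕ → ℤ × ℤ := fun j => (ε * 2 ^ j.1, η * 2 ^ j.2)
  have e : ∀ z, ‖∑ j ∈ S, a j * torusChar (m j) z‖ ^ (2 * k) =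
      ‖∑ t ∈ Fintype.piFinset (fun _ : Fin k => S),
        (∏ i, a (t i)) * torusChar (∑ i, m (t i)) z‖ ^ 2 := by
    intro z
    rw [mul_comm, pow_mul, ← norm_pow]
    congr 2
    have := Finset.prod_univ_sum (fun _ : Fin k => S) (fun _ j => a j * torusChar (m j) z)
    rw [Finset.prod_const, Finset.card_univ, Fintype.card_fin] at this
    rw [this]
    refine Finset.sum_congr rfl fun t _ => ?_
    rw [Finset.prod_mul_distrib, torusChar_sum]
  change ∫ z, ‖∑ j ∈ S, a j * torusChar (m j) z‖ ^ (2 * k) ∂torusMeasure ≤ _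
  simp_rw [e]
  refine (integral_norm_sq_sum_torusChar_le _ _ _ R ?_).trans (le_of_eq ?_)
  · intro t _
    refine hR (∑ i, 2 ^ (t i).1) (∑ i, 2 ^ (t i).2) _ fun s hs => ?_
    have h := (Finset.mem_filter.1 hs).2
    have h1 := congrArg Prod.fst h
    have h2 := congrArg Prod.snd h
    simp only [m, Prod.fst_sum, Prod.snd_sum, ← Finset.mul_sum] at h1 h2
    have h1' := mul_left_cancel₀ hε h1
    have h2' := mul_left_cancel₀ hη h2
    exact ⟨by exact_mod_cast h1', by exact_mod_cast h2'⟩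
  · congr 1
    have := Finset.prod_univ_sum (fun _ : Fin k => S) (fun _ j => ‖a j‖ ^ 2)
    rw [Finset.prod_const, Finset.card_univ, Fintype.card_fin] at this
    rw [this]
    refine Finset.sum_congr rfl fun t _ => ?_
    rw [norm_prod, Finset.prod_pow]

instance : Fact ((0 : ℝ) < 2 * π) := ⟨by positivity⟩

theorem integral_continuousMap_mul_eq_zero {g : ℝ → ℂ}
    (hg : IntegrableOn g (Set.Ioc (0 : ℝ) (2 * π)))
    (h : ∀ n : ℤ, ∫ x in Set.Ioc (0 : ℝ) (2 * π), g x * Complex.exp ((n * Complex.I) * x) = 0)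
    (φ : C(AddCircle (2 * π), ℂ)) :
    ∫ x in Set.Ioc (0 : ℝ) (2 * π), φ (x : AddCircle (2 * π)) * g x = 0 := by
  have hψint : ∀ ψ : C(AddCircle (2 * π), ℂ),
      IntegrableOn (fun x : ℝ => ψ (x : AddCircle (2 * π)) * g x) (Set.Ioc (0 : ℝ) (2 * π)) := by
    intro ψ
    refine hg.bdd_mul (c := ‖ψ‖) ?_ (Filter.Eventually.of_forall fun x => ψ.norm_coe_le_norm _)
    exact (ψ.continuous.comp (AddCircle.continuous_mk' _)).aestronglyMeasurable
  have hspan : ∀ ψ ∈ Submodule.span ℂ (Set.range (@fourier (2 * π))),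
      ∫ x in Set.Ioc (0 : ℝ) (2 * π), ψ (x : AddCircle (2 * π)) * g x = 0 := by
    intro ψ hψ
    induction hψ using Submodule.span_induction with
    | mem ψ hψ =>
      obtain ⟨n, rfl⟩ := hψ
      rw [← h n]
      refine integral_congr_ae (Filter.Eventually.of_forall fun x => ?_)
      simp only []
      rw [fourier_coe_apply, mul_comm]
      congr 2
      have : (π : ℂ) ≠ 0 := by exact_mod_cast pi_ne_zero
      push_cast
      field_simp
    | zero => simp
    | add ψ₁ ψ₂ _ _ h₁ h₂ =>
      simp only [ContinuousMap.add_apply, add_mul]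
      rw [integral_add (hψint ψ₁) (hψint ψ₂), h₁, h₂, add_zero]
    | smul c ψ _ h₁ =>
      simp only [ContinuousMap.smul_apply, smul_eq_mul, mul_assoc]
      rw [integral_const_mul, h₁, mul_zero]
  have hφ : φ ∈ closure ((Submodule.span ℂ (Set.range (@fourier (2 * π))) :
      Submodule ℂ C(AddCircle (2 * π), ℂ)) : Set C(AddCircle (2 * π), ℂ)) := by
    rw [← Submodule.topologicalClosure_coe, span_fourier_closure_eq_top]
    trivial
  rw [← norm_eq_zero]
  refine le_antisymm (le_of_forall_pos_le_add fun ε hε => ?_) (norm_nonneg _)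
  set K := ∫ x in Set.Ioc (0 : ℝ) (2 * π), ‖g x‖ with hK
  have hK0 : 0 ≤ K := integral_nonneg fun _ => norm_nonneg _
  obtain ⟨ψ, hψ, hd⟩ := Metric.mem_closure_iff.1 hφ (ε / (K + 1)) (by positivity)
  have e : ∫ x in Set.Ioc (0 : ℝ) (2 * π), φ (x : AddCircle (2 * π)) * g x =
      ∫ x in Set.Ioc (0 : ℝ) (2 * π), (φ - ψ) (x : AddCircle (2 * π)) * g x := by
    simp only [ContinuousMap.sub_apply, sub_mul]
    rw [integral_sub (hψint φ) (hψint ψ), hspan ψ hψ, sub_zero]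
  rw [e, zero_add]
  calc ‖∫ x in Set.Ioc (0 : ℝ) (2 * π), (φ - ψ) (x : AddCircle (2 * π)) * g x‖
      ≤ ∫ x in Set.Ioc (0 : ℝ) (2 * π), ε / (K + 1) * ‖g x‖ := by
        refine norm_integral_le_of_norm_le (hg.norm.const_mul _)
          (Filter.Eventually.of_forall fun x => ?_)
        rw [norm_mul]
        refine mul_le_mul_of_nonneg_right ?_ (norm_nonneg _)
        exact ((φ - ψ).norm_coe_le_norm _).trans (by rw [← dist_eq_norm]; exact hd.le)
    _ = ε / (K + 1) * K := by rw [integral_const_mul]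
    _ ≤ ε / (K + 1) * (K + 1) := by gcongr; linarith
    _ = ε := by field_simp

theorem ae_eq_zero_of_integral_mul_exp_eq_zero {g : ℝ → ℂ}
    (hg : IntegrableOn g (Set.Ioc (0 : ℝ) (2 * π)))
    (h : ∀ n : ℤ, ∫ x in Set.Ioc (0 : ℝ) (2 * π), g x * Complex.exp ((n * Complex.I) * x) = 0) :
    g =ᵐ[volume.restrict (Set.Ioc (0 : ℝ) (2 * π))] 0 := by
  have hU : ∀ᵐ x : ℝ, x ∈ Set.Ioo (0 : ℝ) (2 * π) → g x = 0 := by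
    refine isOpen_Ioo.ae_eq_zero_of_integral_contDiff_smul_eq_zero
      ((hg.mono_set Set.Ioo_subset_Ioc_self).locallyIntegrableOn) ?_
    intro ψ hψ _ hsupp
    have hz : ∀ x, x ∉ Set.Ioo (0 : ℝ) (2 * π) → ψ x = 0 := fun x hx =>
      image_eq_zero_of_notMem_tsupport fun hx' => hx (hsupp hx')
    let φ : C(AddCircle (2 * π), ℂ) :=
      ⟨AddCircle.liftIoc (2 * π) 0 fun x => (ψ x : ℂ), AddCircle.liftIoc_continuous
        (by rw [hz 0 (by simp), hz (0 + 2 * π) (by simp)])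
        (Complex.continuous_ofReal.comp hψ.continuous).continuousOn⟩
    rw [← integral_continuousMap_mul_eq_zero hg h φ,
      ← setIntegral_eq_integral_of_forall_compl_eq_zero (s := Set.Ioc (0 : ℝ) (2 * π))]
    · refine setIntegral_congr_fun measurableSet_Ioc fun x hx => ?_
      simp only [φ, ContinuousMap.coe_mk]
      rw [AddCircle.liftIoc_zero_coe_apply hx, Complex.real_smul]
    · intro x hx
      rw [hz x fun hx' => hx (Set.Ioo_subset_Ioc_self hx'), zero_smul]
  rw [← restrict_Ioo_eq_restrict_Ioc]
  exact (ae_restrict_iff' measurableSet_Ioo).2 hU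

/-- Unnormalized Fourier coefficients on the period square. -/
def torusCoeff (G : ℝ × ℝ → ℂ) (n : ℤ × ℤ) : ℂ := ∫ z, G z * torusChar (-n) z ∂torusMeasure

theorem integrable_mul_torusChar {G : ℝ × ℝ → ℂ} (hG : Integrable G torusMeasure) (n : ℤ × ℤ) :
    Integrable (fun z => G z * torusChar n z) torusMeasure :=
  hG.mul_bdd (c := 1) (continuous_torusChar n).aestronglyMeasurable
    (Filter.Eventually.of_forall fun z => (norm_torusChar n z).le)

theorem ae_eq_zero_of_torusCoeff_eq_zero {G : ℝ × ℝ → ℂ} (hG : Integrable G torusMeasure)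
    (h : ∀ n, torusCoeff G n = 0) : G =ᵐ[torusMeasure] 0 := by
  have hm : ∀ m : ℤ, ∀ᵐ y ∂(volume.restrict (Set.Ioc (0 : ℝ) (2 * π))),
      ∫ x in Set.Ioc (0 : ℝ) (2 * π), G (x, y) * Complex.exp ((m * Complex.I) * x) = 0 := by
    intro m
    have hGm : Integrable (fun z : ℝ × ℝ => G z * Complex.exp ((m * Complex.I) * z.1))
        torusMeasure := by
      simpa [torusChar_eq_mul] using integrable_mul_torusChar hG (m, 0)
    refine ae_eq_zero_of_integral_mul_exp_eq_zero hGm.integral_prod_right fun n => ?_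
    have h1 := h (-m, -n)
    have h2 : Integrable (fun z : ℝ × ℝ => G z * torusChar (-(-m, -n)) z) torusMeasure :=
      integrable_mul_torusChar hG _
    rw [torusCoeff, torusMeasure, integral_prod_symm _ h2] at h1
    rw [← h1]
    refine integral_congr_ae (Filter.Eventually.of_forall fun y => ?_)
    simp only []
    rw [← integral_mul_const]
    refine integral_congr_ae (Filter.Eventually.of_forall fun x => ?_)
    simp only [torusChar_eq_mul]
    simp [mul_assoc]
  have hy : ∀ᵐ y ∂(volume.restrict (Set.Ioc (0 : ℝ) (2 * π))),
      ∫⁻ x in Set.Ioc (0 : ℝ) (2 * π), ‖G (x, y)‖ₑ = 0 := by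
    have hG' : Integrable G ((volume.restrict (Set.Ioc (0 : ℝ) (2 * π))).prod
      (volume.restrict (Set.Ioc (0 : ℝ) (2 * π)))) := hG
    filter_upwards [ae_all_iff.2 hm, hG'.prod_left_ae] with y h1 h2
    have h3 := ae_eq_zero_of_integral_mul_exp_eq_zero h2 h1
    rw [lintegral_congr_ae (g := fun _ => 0), lintegral_zero]
    filter_upwards [h3] with x hx
    rw [hx]
    simp
  have h0 : ∫⁻ z, ‖G z‖ₑ ∂torusMeasure = 0 := by
    rw [torusMeasure, lintegral_prod_symm _ hG.aestronglyMeasurable.enorm,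
      lintegral_congr_ae hy, lintegral_zero]
  rw [lintegral_eq_zero_iff' hG.aestronglyMeasurable.enorm] at h0
  filter_upwards [h0] with z hz
  simpa using hz

/-- The sign encoded by a Boolean. -/
def boolSign (b : Bool) : ℤ := if b then 1 else -1

theorem boolSign_ne_zero (b : Bool) : boolSign b ≠ 0 := by
  cases b <;> simp [boolSign]

/-- The double lacunary frequencies `(± 2 ^ μ₁, ± 2 ^ μ₂)`. -/
def lacFreq (i : (ℕ × ℕ) × (Bool × Bool)) : ℤ × ℤ :=
  (boolSign i.2.1 * 2 ^ i.1.1, boolSign i.2.2 * 2 ^ i.1.2)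

theorem boolSign_mul_two_pow_inj {a b : Bool} {m n : ℕ}
    (h : boolSign a * 2 ^ m = boolSign b * 2 ^ n) : m = n ∧ a = b := by
  have hm : (0 : ℤ) < 2 ^ m := by positivity
  have hn : (0 : ℤ) < 2 ^ n := by positivity
  have hinj : (2 : ℤ) ^ m = 2 ^ n → m = n := fun h =>
    Nat.pow_right_injective le_rfl (by exact_mod_cast h)
  cases a <;> cases b <;> simp [boolSign] at h ⊢
  · exact h
  · omega
  · omega
  · exact h

theorem lacFreq_injective : Function.Injective lacFreq := by
  rintro ⟨⟨m, n⟩, ⟨a, b⟩⟩ ⟨⟨m', n'⟩, ⟨a', b'⟩⟩ h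
  simp only [lacFreq, Prod.mk.injEq] at h ⊢
  obtain ⟨h1, h2⟩ := boolSign_mul_two_pow_inj h.1
  obtain ⟨h3, h4⟩ := boolSign_mul_two_pow_inj h.2
  exact ⟨⟨h1, h3⟩, h2, h4⟩

/-- Double lacunary trigonometric polynomials. -/
def lacPoly (a : (ℕ × ℕ) × (Bool × Bool) → ℂ) (T : Finset ((ℕ × ℕ) × (Bool × Bool)))
    (z : ℝ × ℝ) : ℂ :=
  ∑ i ∈ T, a i * torusChar (lacFreq i) z

theorem continuous_lacPoly (a : (ℕ × ℕ) × (Bool × Bool) → ℂ)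
    (T : Finset ((ℕ × ℕ) × (Bool × Bool))) : Continuous (lacPoly a T) :=
  continuous_finsetSum _ fun _ _ => continuous_const.mul (continuous_torusChar _)

theorem norm_lacPoly_le (a : (ℕ × ℕ) × (Bool × Bool) → ℂ)
    (T : Finset ((ℕ × ℕ) × (Bool × Bool))) (z : ℝ × ℝ) : ‖lacPoly a T z‖ ≤ ∑ i ∈ T, ‖a i‖ := by
  refine (norm_sum_le _ _).trans (Finset.sum_le_sum fun _ _ => ?_)
  rw [norm_mul, norm_torusChar, mul_one]

theorem memLp_lacPoly (a : (ℕ × ℕ) × (Bool × Bool) → ℂ)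
    (T : Finset ((ℕ × ℕ) × (Bool × Bool))) (q : ℝ≥0∞) : MemLp (lacPoly a T) q torusMeasure :=
  MemLp.of_bound (continuous_lacPoly a T).aestronglyMeasurable _
    (Filter.Eventually.of_forall (norm_lacPoly_le a T))

theorem exists_eLpNorm_even_lacunary_le {k : ℕ} (hk : k ≠ 0) :
    ∃ D : ℝ, 0 ≤ D ∧ ∀ (ε η : ℤ), ε ≠ 0 → η ≠ 0 → ∀ (S : Finset (ℕ × ℕ)) (a : ℕ × ℕ → ℂ),
      eLpNorm (fun z => ∑ j ∈ S, a j * torusChar (ε * 2 ^ j.1, η * 2 ^ j.2) z)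
        ((2 * k : ℕ) : ℝ≥0∞) torusMeasure ≤ ENNReal.ofReal (D * √(∑ j ∈ S, ‖a j‖ ^ 2)) := by
  obtain ⟨D, hD, h⟩ := exists_integral_norm_pow_lacunary_le k
  refine ⟨D ^ ((2 * k : ℕ) : ℝ)⁻¹, by positivity, fun ε η hε hη S a => ?_⟩
  have hmem : MemLp (fun z => ∑ j ∈ S, a j * torusChar (ε * 2 ^ j.1, η * 2 ^ j.2) z)
      ((2 * k : ℕ) : ℝ≥0∞) torusMeasure :=
    memLp_finsetSum _ fun j _ => MemLp.of_bound
      (continuous_const.mul (continuous_torusChar _)).aestronglyMeasurable ‖a j‖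
      (Filter.Eventually.of_forall fun z => by rw [norm_mul, norm_torusChar, mul_one])
  rw [hmem.eLpNorm_eq_integral_rpow_norm (by simpa using hk) (ENNReal.natCast_ne_top _)]
  refine ENNReal.ofReal_le_ofReal ?_
  rw [ENNReal.toReal_natCast]
  simp_rw [Real.rpow_natCast]
  have hk' : (k : ℝ) ≠ 0 := by exact_mod_cast hk
  have hs : 0 ≤ ∑ j ∈ S, ‖a j‖ ^ 2 := Finset.sum_nonneg fun _ _ => sq_nonneg _
  calc _ ≤ (D * (∑ j ∈ S, ‖a j‖ ^ 2) ^ k) ^ ((2 * k : ℕ) : ℝ)⁻¹ :=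
        Real.rpow_le_rpow (integral_nonneg fun _ => by positivity) (h ε η hε hη S a)
          (by positivity)
    _ = _ := by
      rw [Real.mul_rpow hD (by positivity), ← Real.rpow_natCast, ← Real.rpow_mul hs,
        Real.sqrt_eq_rpow]
      congr 2
      push_cast
      field_simp

theorem exists_eLpNorm_lacPoly_le {q : ℝ≥0∞} (hq : q ≠ ⊤) :
    ∃ D : ℝ, 0 < D ∧ ∀ (a : (ℕ × ℕ) × (Bool × Bool) → ℂ) (T : Finset ((ℕ × ℕ) × (Bool × Bool))),
      eLpNorm (lacPoly a T) q torusMeasure ≤ ENNReal.ofReal (D * √(∑ i ∈ T, ‖a i‖ ^ 2)) := by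
  obtain ⟨k, hk⟩ := exists_nat_ge (q.toReal + 1)
  have hk0 : k ≠ 0 := by
    rintro rfl
    have := q.toReal_nonneg
    norm_num at hk
    linarith
  obtain ⟨D, hD, h⟩ := exists_eLpNorm_even_lacunary_le hk0
  have hqk : q ≤ ((2 * k : ℕ) : ℝ≥0∞) := by
    rw [← ENNReal.ofReal_toReal hq, ← ENNReal.ofReal_natCast]
    refine ENNReal.ofReal_le_ofReal ?_
    push_cast
    have := q.toReal_nonneg
    linarith
  set V := torusMeasure Set.univ ^ (1 / q.toReal - 1 / ((2 * k : ℕ) : ℝ≥0∞).toReal) with hV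
  by_cases hq0 : q = 0
  · refine ⟨1, one_pos, fun a T => ?_⟩
    simp [hq0]
  have hVtop : V ≠ ⊤ := by
    refine ENNReal.rpow_ne_top_of_nonneg ?_ (measure_ne_top _ _)
    rw [sub_nonneg]
    exact one_div_le_one_div_of_le (ENNReal.toReal_pos hq0 hq)
      (ENNReal.toReal_mono (ENNReal.natCast_ne_top _) hqk)
  refine ⟨4 * D * V.toReal + 1, by positivity, fun a T => ?_⟩
  classical
  set X := √(∑ i ∈ T, ‖a i‖ ^ 2) with hX
  let S := T.image Prod.fst
  let a' : (ℕ × ℕ) × (Bool × Bool) → ℂ := fun i => if i ∈ T then a i else 0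
  have hTS : T ⊆ S ×ˢ (Finset.univ : Finset (Bool × Bool)) := fun i hi =>
    Finset.mem_product.2 ⟨Finset.mem_image_of_mem _ hi, Finset.mem_univ _⟩
  have e1 : lacPoly a T = ∑ σ : Bool × Bool, fun z => ∑ j ∈ S, a' (j, σ) *
      torusChar (boolSign σ.1 * 2 ^ j.1, boolSign σ.2 * 2 ^ j.2) z := by
    funext z
    rw [Finset.sum_apply, lacPoly,
      ← Finset.sum_product_right' S Finset.univ (fun j σ => a' (j, σ) *
        torusChar (boolSign σ.1 * 2 ^ j.1, boolSign σ.2 * 2 ^ j.2) z)]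
    rw [← Finset.sum_subset hTS]
    · refine Finset.sum_congr rfl fun i hi => ?_
      simp only [a', Prod.mk.eta, if_pos hi]
      rfl
    · intro i _ hi
      simp [a', hi]
  have hσ : ∀ σ : Bool × Bool, √(∑ j ∈ S, ‖a' (j, σ)‖ ^ 2) ≤ X := by
    intro σ
    refine Real.sqrt_le_sqrt ?_
    have e2 : ∑ i ∈ T, ‖a i‖ ^ 2 = ∑ σ, ∑ j ∈ S, ‖a' (j, σ)‖ ^ 2 := by
      rw [← Finset.sum_product_right' S Finset.univ (fun j σ => ‖a' (j, σ)‖ ^ 2),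
        ← Finset.sum_subset hTS]
      · refine Finset.sum_congr rfl fun i hi => ?_
        simp only [a', Prod.mk.eta, if_pos hi]
      · intro i _ hi
        simp [a', hi]
    rw [e2]
    exact Finset.single_le_sum (f := fun σ => ∑ j ∈ S, ‖a' (j, σ)‖ ^ 2)
      (fun _ _ => Finset.sum_nonneg fun _ _ => sq_nonneg _) (Finset.mem_univ σ)
  have h1 : (1 : ℝ≥0∞) ≤ ((2 * k : ℕ) : ℝ≥0∞) := by
    exact_mod_cast (by omega : 1 ≤ 2 * k)
  have h2 : eLpNorm (lacPoly a T) ((2 * k : ℕ) : ℝ≥0∞) torusMeasure ≤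
      ENNReal.ofReal (4 * D * X) := by
    rw [e1]
    refine (eLpNorm_sum_le (fun σ _ => ?_) h1).trans ?_
    · exact (continuous_finsetSum _ fun j _ =>
        continuous_const.mul (continuous_torusChar _)).aestronglyMeasurable
    · calc _ ≤ ∑ σ : Bool × Bool, ENNReal.ofReal (D * X) := by
            refine Finset.sum_le_sum fun σ _ => ?_
            refine (h _ _ (boolSign_ne_zero _) (boolSign_ne_zero _) S _).trans ?_
            exact ENNReal.ofReal_le_ofReal (mul_le_mul_of_nonneg_left (hσ σ) hD)
        _ = _ := by
          rw [Finset.sum_const, nsmul_eq_mul, ← ENNReal.ofReal_natCast,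
            ← ENNReal.ofReal_mul (by positivity)]
          congr 1
          simp
          ring
  refine (eLpNorm_le_eLpNorm_mul_rpow_measure_univ hqk
    (continuous_lacPoly a T).aestronglyMeasurable).trans ?_
  refine (mul_le_mul_left h2 V).trans ?_
  rw [← ENNReal.ofReal_toReal hVtop, ← ENNReal.ofReal_mul (by positivity)]
  refine ENNReal.ofReal_le_ofReal ?_
  rw [ENNReal.toReal_ofReal ENNReal.toReal_nonneg]
  nlinarith [Real.sqrt_nonneg (∑ i ∈ T, ‖a i‖ ^ 2)]

theorem exists_tsum_torusCoeff_sq_le {p : ℝ} (hp : 1 < p) :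
    ∃ C : ℝ, 0 < C ∧ ∀ G : ℝ × ℝ → ℂ, Integrable G torusMeasure →
      ∑' i, ‖torusCoeff G (lacFreq i)‖ₑ ^ 2 ≤
        ENNReal.ofReal C * eLpNorm G (ENNReal.ofReal p) torusMeasure ^ 2 := by
  have hpq := Real.HolderConjugate.conjExponent hp
  obtain ⟨D, hD, h⟩ := exists_eLpNorm_lacPoly_le (q := ENNReal.ofReal p.conjExponent)
    ENNReal.ofReal_ne_top
  refine ⟨D ^ 2, by positivity, fun G hG => ?_⟩
  rw [ENNReal.tsum_eq_iSup_sum]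
  refine iSup_le fun T => ?_
  set c := fun i => torusCoeff G (lacFreq i) with hc
  set N := eLpNorm G (ENNReal.ofReal p) torusMeasure with hN
  set X := ∑ i ∈ T, ‖c i‖ ^ 2 with hX
  have hX0 : 0 ≤ X := Finset.sum_nonneg fun _ _ => sq_nonneg _
  have e0 : ∑ i ∈ T, ‖c i‖ₑ ^ 2 = ENNReal.ofReal X := by
    rw [hX, ENNReal.ofReal_sum_of_nonneg fun _ _ => sq_nonneg _]
    refine Finset.sum_congr rfl fun i _ => ?_
    rw [ENNReal.ofReal_pow (norm_nonneg _), ofReal_norm]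
  have e1 : ∫ z, G z * (starRingEnd ℂ) (lacPoly c T z) ∂torusMeasure = (X : ℂ) := by
    have : ∀ z, G z * (starRingEnd ℂ) (lacPoly c T z) =
        ∑ i ∈ T, (starRingEnd ℂ) (c i) * (G z * torusChar (-lacFreq i) z) := by
      intro z
      rw [lacPoly, map_sum, Finset.mul_sum]
      refine Finset.sum_congr rfl fun i _ => ?_
      rw [map_mul, conj_torusChar]
      ring
    simp_rw [this]
    rw [integral_finsetSum _ fun i _ => (integrable_mul_torusChar hG _).const_mul _, hX]
    push_cast
    refine Finset.sum_congr rfl fun i _ => ?_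
    rw [integral_const_mul, ← Complex.conj_mul']
    rfl
  have e2 : ENNReal.ofReal X ≤ N * ENNReal.ofReal (D * √X) := by
    have : ENNReal.ofReal X = ‖(X : ℂ)‖ₑ := by
      rw [← ofReal_norm, Complex.norm_real, Real.norm_of_nonneg hX0]
    rw [this, ← e1]
    refine (enorm_integral_le_lintegral_enorm _).trans ?_
    rw [← eLpNorm_one_eq_lintegral_enorm]
    have hH : (ENNReal.ofReal p).HolderConjugate (ENNReal.ofReal p.conjExponent) :=
      hpq.ennrealOfReal
    have hm := (continuous_lacPoly c T).aestronglyMeasurable (μ := torusMeasure)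
    have hm' : AEStronglyMeasurable (fun z => (starRingEnd ℂ) (lacPoly c T z)) torusMeasure :=
      (Complex.continuous_conj.comp (continuous_lacPoly c T)).aestronglyMeasurable
    refine (eLpNorm_smul_le_mul_eLpNorm (p := ENNReal.ofReal p)
      (q := ENNReal.ofReal p.conjExponent) (r := 1) hm' hG.aestronglyMeasurable).trans ?_
    refine mul_le_mul_right ?_ N
    refine le_trans (le_of_eq (eLpNorm_congr_norm_ae
      (Filter.Eventually.of_forall fun z => ?_))) (h c T)
    exact RCLike.norm_conj _
  rw [e0]
  by_cases hX1 : X = 0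
  · simp [hX1]
  have hXpos : 0 < X := lt_of_le_of_ne hX0 (Ne.symm hX1)
  have e3 : ENNReal.ofReal X * ENNReal.ofReal X ≤
      ENNReal.ofReal (D ^ 2) * N ^ 2 * ENNReal.ofReal X := by
    calc _ ≤ (N * ENNReal.ofReal (D * √X)) * (N * ENNReal.ofReal (D * √X)) :=
          mul_le_mul' e2 e2
      _ = N ^ 2 * (ENNReal.ofReal (D * √X) * ENNReal.ofReal (D * √X)) := by ring
      _ = N ^ 2 * ENNReal.ofReal (D ^ 2 * X) := by
        rw [← ENNReal.ofReal_mul (by positivity)]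
        congr 2
        nlinarith [Real.mul_self_sqrt hX0]
      _ = _ := by
        rw [ENNReal.ofReal_mul (by positivity)]
        ring
  exact (ENNReal.mul_le_mul_iff_left (by simpa using hXpos) ENNReal.ofReal_ne_top).1 e3

theorem torusCoeff_lacPoly (a : (ℕ × ℕ) × (Bool × Bool) → ℂ)
    (T : Finset ((ℕ × ℕ) × (Bool × Bool))) (n : ℤ × ℤ) :
    torusCoeff (lacPoly a T) n =
      ∑ i ∈ T, a i * (if lacFreq i = n then (4 * π ^ 2 : ℂ) else 0) := by
  have : ∀ z, lacPoly a T z * torusChar (-n) z =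
      ∑ i ∈ T, a i * torusChar (lacFreq i - n) z := by
    intro z
    rw [lacPoly, Finset.sum_mul]
    refine Finset.sum_congr rfl fun i _ => ?_
    rw [sub_eq_add_neg, torusChar_add, mul_assoc]
  simp_rw [torusCoeff, this]
  rw [integral_finsetSum _ fun i _ => (integrable_torusChar _).const_mul _]
  refine Finset.sum_congr rfl fun i _ => ?_
  rw [integral_const_mul, integral_torusChar]
  simp only [sub_eq_zero]

theorem exists_eLpNorm_sq_le_tsum_torusCoeff {p : ℝ} (hp : 1 ≤ p) :
    ∃ C : ℝ, 0 < C ∧ ∀ G : ℝ × ℝ → ℂ, Integrable G torusMeasure →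
      (∀ n, n ∉ Set.range lacFreq → torusCoeff G n = 0) →
      eLpNorm G (ENNReal.ofReal p) torusMeasure ^ 2 ≤
        ENNReal.ofReal C * ∑' i, ‖torusCoeff G (lacFreq i)‖ₑ ^ 2 := by
  set P := ENNReal.ofReal p with hP
  have hP1 : 1 ≤ P := by simpa [hP] using hp
  have : Fact (1 ≤ P) := ⟨hP1⟩
  obtain ⟨D, hD, h⟩ := exists_eLpNorm_lacPoly_le (q := P) ENNReal.ofReal_ne_top
  refine ⟨D ^ 2, by positivity, fun G hG hG0 => ?_⟩
  set c := fun i => torusCoeff G (lacFreq i) with hc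
  by_cases htop : ∑' i, ‖c i‖ₑ ^ 2 = ⊤
  · rw [htop, ENNReal.mul_top (by simpa using hD.ne')]
    exact le_top
  have hsum : Summable fun i => ‖c i‖ ^ 2 := by
    have := ENNReal.summable_toReal htop
    simpa using this
  set Y := ∑' i, ‖c i‖ ^ 2 with hY
  have hYe : ∑' i, ‖c i‖ₑ ^ 2 = ENNReal.ofReal Y := by
    rw [hY, ENNReal.ofReal_tsum_of_nonneg (fun _ => sq_nonneg _) hsum]
    refine tsum_congr fun i => ?_
    rw [ENNReal.ofReal_pow (norm_nonneg _), ofReal_norm]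
  have hpi : (1 : ℝ) ≤ 4 * π ^ 2 := by nlinarith [pi_gt_three]
  have hpi0 : (4 * π ^ 2 : ℂ) ≠ 0 := by simp
  let a : (ℕ × ℕ) × (Bool × Bool) → ℂ := fun i => c i / (4 * π ^ 2)
  have ha : ∀ i, ‖a i‖ ^ 2 ≤ ‖c i‖ ^ 2 := by
    intro i
    refine pow_le_pow_left₀ (norm_nonneg _) ?_ 2
    simp only [a]
    rw [norm_div, show (4 * π ^ 2 : ℂ) = ((4 * π ^ 2 : ℝ) : ℂ) by push_cast; ring,
      Complex.norm_real, Real.norm_of_nonneg (by positivity)]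
    exact div_le_self (norm_nonneg _) hpi
  let u : (ℕ × ℕ) × (Bool × Bool) → Lp ℂ P torusMeasure := fun i =>
    (memLp_lacPoly a {i} P).toLp (lacPoly a {i})
  have hu : ∀ T : Finset ((ℕ × ℕ) × (Bool × Bool)),
      ((∑ i ∈ T, u i : Lp ℂ P torusMeasure) : ℝ × ℝ → ℂ) =ᵐ[torusMeasure] lacPoly a T := by
    intro T
    have h1 : ∀ᵐ z ∂torusMeasure, ∀ i, u i z = lacPoly a {i} z :=
      ae_all_iff.2 fun i => MemLp.coeFn_toLp _
    filter_upwards [Lp.coeFn_finsetSum T u, h1] with z hz h1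
    rw [hz, Finset.sum_apply, lacPoly]
    refine Finset.sum_congr rfl fun i _ => ?_
    rw [h1, lacPoly, Finset.sum_singleton]
  have hnorm : ∀ T : Finset ((ℕ × ℕ) × (Bool × Bool)),
      ‖∑ i ∈ T, u i‖ ≤ D * √(∑ i ∈ T, ‖c i‖ ^ 2) := by
    intro T
    rw [Lp.norm_def, eLpNorm_congr_ae (hu T)]
    refine ENNReal.toReal_le_of_le_ofReal (by positivity) ((h a T).trans ?_)
    refine ENNReal.ofReal_le_ofReal (mul_le_mul_of_nonneg_left (Real.sqrt_le_sqrt ?_) hD.le)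
    exact Finset.sum_le_sum fun i _ => ha i
  have hus : Summable u := by
    rw [summable_iff_vanishing_norm]
    intro ε hε
    obtain ⟨s, hs⟩ := summable_iff_vanishing_norm.1 hsum ((ε / D) ^ 2) (by positivity)
    refine ⟨s, fun t ht => (hnorm t).trans_lt ?_⟩
    have h2 := hs t ht
    rw [Real.norm_of_nonneg (Finset.sum_nonneg fun _ _ => sq_nonneg _)] at h2
    have h3 : √(∑ i ∈ t, ‖c i‖ ^ 2) < ε / D := by
      rw [Real.sqrt_lt' (by positivity)]
      exact h2
    rwa [lt_div_iff₀' hD] at h3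
  set S := ∑' i, u i with hS
  have hSnorm : ‖S‖ ≤ D * √Y := by
    refine le_of_tendsto hus.hasSum.norm (Filter.Eventually.of_forall fun T => ?_)
    refine (hnorm T).trans (mul_le_mul_of_nonneg_left (Real.sqrt_le_sqrt ?_) hD.le)
    exact hsum.sum_le_tsum T fun _ _ => sq_nonneg _
  have hSint : Integrable S torusMeasure := (Lp.memLp S).integrable hP1
  have hcoeff : ∀ n, HasSum (fun i => a i * (if lacFreq i = n then (4 * π ^ 2 : ℂ) else 0))
      (torusCoeff S n) := by
    intro n
    have ht := (Lp.tendsto_Lp_iff_tendsto_eLpNorm' _ _).1 hus.hasSum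
    have ht1 : Filter.Tendsto (fun T => eLpNorm
        ((fun z => lacPoly a T z * torusChar (-n) z) - fun z => S z * torusChar (-n) z) 1
        torusMeasure) Filter.atTop (nhds 0) := by
      set V := torusMeasure Set.univ ^ (1 / (1 : ℝ≥0∞).toReal - 1 / P.toReal) with hV
      have hVtop : V ≠ ⊤ := by
        refine ENNReal.rpow_ne_top_of_nonneg ?_ (measure_ne_top _ _)
        rw [sub_nonneg]
        exact one_div_le_one_div_of_le (by simp) (ENNReal.toReal_mono ENNReal.ofReal_ne_top hP1)
      have ht2 := ENNReal.Tendsto.mul_const ht (Or.inr hVtop)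
      rw [zero_mul] at ht2
      refine tendsto_of_tendsto_of_tendsto_of_le_of_le tendsto_const_nhds ht2
        (fun _ => zero_le) fun T => ?_
      have e : eLpNorm ((fun z => lacPoly a T z * torusChar (-n) z) -
          fun z => S z * torusChar (-n) z) 1 torusMeasure =
          eLpNorm (((∑ i ∈ T, u i : Lp ℂ P torusMeasure) : ℝ × ℝ → ℂ) - ⇑S) 1 torusMeasure := by
        refine eLpNorm_congr_norm_ae ?_
        filter_upwards [hu T] with z hz
        rw [Pi.sub_apply, Pi.sub_apply, ← sub_mul, norm_mul, norm_torusChar, mul_one, hz]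
      simp only []
      rw [e]
      exact eLpNorm_le_eLpNorm_mul_rpow_measure_univ hP1
        ((Lp.aestronglyMeasurable _).sub (Lp.aestronglyMeasurable _))
    have ht3 := tendsto_integral_of_L1' _ (integrable_mul_torusChar hSint (-n)).aestronglyMeasurable
      (Filter.Eventually.of_forall fun T => integrable_mul_torusChar
        ((memLp_lacPoly a T 1).integrable le_rfl) (-n)) ht1
    refine ht3.congr fun T => ?_
    exact torusCoeff_lacPoly a T n
  have hzero : ∀ n, torusCoeff (G - S) n = 0 := by
    intro n
    have e : torusCoeff (G - S) n = torusCoeff G n - torusCoeff S n := by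
      simp_rw [torusCoeff, Pi.sub_apply, sub_mul]
      exact integral_sub (integrable_mul_torusChar hG _) (integrable_mul_torusChar hSint _)
    rw [e, sub_eq_zero]
    by_cases hn : n ∈ Set.range lacFreq
    · obtain ⟨i, rfl⟩ := hn
      refine HasSum.unique ?_ (hcoeff (lacFreq i))
      have := hasSum_single (f := fun j => a j * (if lacFreq j = lacFreq i then (4 * π ^ 2 : ℂ)
        else 0)) i fun j hj => by
          rw [if_neg fun h => hj (lacFreq_injective h), mul_zero]
      rw [if_pos rfl] at this
      convert this using 1
      simp only [a, hc]
      field_simp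
    · rw [hG0 n hn]
      refine HasSum.unique ?_ (hcoeff n)
      convert hasSum_zero with i
      rw [if_neg fun h => hn ⟨i, h⟩, mul_zero]
  have hae : G =ᵐ[torusMeasure] S := by
    filter_upwards [ae_eq_zero_of_torusCoeff_eq_zero (hG.sub hSint) hzero] with z hz
    exact sub_eq_zero.1 hz
  rw [eLpNorm_congr_ae hae, ← Lp.enorm_def, ← ofReal_norm, hYe,
    ← ENNReal.ofReal_mul (by positivity), ← ENNReal.ofReal_pow (norm_nonneg _)]
  refine ENNReal.ofReal_le_ofReal ?_
  have hY0 : 0 ≤ Y := tsum_nonneg fun _ => sq_nonneg _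
  calc ‖S‖ ^ 2 ≤ (D * √Y) ^ 2 := pow_le_pow_left₀ (norm_nonneg _) hSnorm 2
    _ = _ := by rw [mul_pow, Real.sq_sqrt hY0]

theorem ae_summable_and_integrable_tsum {Ω ι : Type*} [MeasurableSpace Ω] {μ : Measure Ω}
    [Countable ι] {T : ι → Ω → ℂ} (hT : ∀ i, Integrable (T i) μ)
    (hs : Summable fun i => ∫ z, ‖T i z‖ ∂μ) :
    (∀ᵐ z ∂μ, Summable fun i => ‖T i z‖) ∧ Integrable (fun z => ∑' i, T i z) μ := by
  have hfin : ∫⁻ z, ∑' i, ‖T i z‖ₑ ∂μ < ⊤ := by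
    rw [lintegral_tsum fun i => (hT i).aestronglyMeasurable.enorm]
    have e : ∀ i, ∫⁻ z, ‖T i z‖ₑ ∂μ = ENNReal.ofReal (∫ z, ‖T i z‖ ∂μ) := fun i =>
      (ofReal_integral_norm_eq_lintegral_enorm (hT i)).symm
    simp_rw [e]
    rw [← ENNReal.ofReal_tsum_of_nonneg (fun _ => integral_nonneg fun _ => norm_nonneg _) hs]
    exact ENNReal.ofReal_lt_top
  have hae : ∀ᵐ z ∂μ, Summable fun i => ‖T i z‖ := by
    filter_upwards [ae_lt_top' (AEMeasurable.tsum
      fun i => (hT i).aestronglyMeasurable.enorm) hfin.ne] with z hz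
    exact NNReal.summable_coe.2 (ENNReal.tsum_coe_ne_top_iff_summable.1 hz.ne)
  refine ⟨hae, ?_, ?_⟩
  · refine aestronglyMeasurable_of_tendsto_ae (Filter.atTop : Filter (Finset ι))
      (f := fun s z => ∑ i ∈ s, T i z)
      (fun s => Finset.aestronglyMeasurable_fun_sum s fun i _ => (hT i).aestronglyMeasurable) ?_
    filter_upwards [hae] with z hz
    exact hz.of_norm.hasSum
  · refine (lintegral_mono_ae ?_).trans_lt hfin
    filter_upwards [hae] with z hz
    exact enorm_tsum_le_tsum_enorm

theorem lintegral_Ioc_add_of_periodic {φ : ℝ → ℝ≥0∞} (hφ : Function.Periodic φ (2 * π)) (a : ℝ) :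
    ∫⁻ x in Set.Ioc (0 : ℝ) (2 * π), φ (x + a) = ∫⁻ x in Set.Ioc (0 : ℝ) (2 * π), φ x := by
  have hπ : (0 : ℝ) < 2 * π := by positivity
  have h1 : ∫⁻ x in Set.Ioc (0 : ℝ) (2 * π), φ (x + a) = ∫⁻ x in Set.Ioc a (a + 2 * π), φ x := by
    have := (measurePreserving_add_right (volume : Measure ℝ) a).setLIntegral_comp_preimage_emb
      (measurableEmbedding_addRight a) φ (Set.Ioc a (a + 2 * π))
    rw [← this]
    simp
  have h2 := (isAddFundamentalDomain_Ioc hπ a).setLIntegral_eq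
    (isAddFundamentalDomain_Ioc hπ 0) φ (by
      rintro ⟨_, n, rfl⟩ x
      rw [AddSubgroup.vadd_def, vadd_eq_add, add_comm]
      exact hφ.zsmul n x)
  rw [h1, h2, zero_add]

theorem lintegral_torus_add_of_periodic {φ : ℝ × ℝ → ℝ≥0∞} (hm : Measurable φ)
    (hx : ∀ y, Function.Periodic (fun x => φ (x, y)) (2 * π))
    (hy : ∀ x, Function.Periodic (fun y => φ (x, y)) (2 * π)) (a : ℝ × ℝ) :
    ∫⁻ z, φ (z + a) ∂torusMeasure = ∫⁻ z, φ z ∂torusMeasure := by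
  have hma : Measurable fun z => φ (z + a) := hm.comp (measurable_add_const a)
  rw [torusMeasure, lintegral_prod _ hma.aemeasurable, lintegral_prod _ hm.aemeasurable]
  have e : ∀ x, ∫⁻ y in Set.Ioc (0 : ℝ) (2 * π), φ ((x, y) + a) =
      ∫⁻ y in Set.Ioc (0 : ℝ) (2 * π), φ (x + a.1, y) := fun x =>
    lintegral_Ioc_add_of_periodic (hy (x + a.1)) a.2
  simp_rw [e]
  refine lintegral_Ioc_add_of_periodic (φ := fun x => ∫⁻ y in Set.Ioc (0 : ℝ) (2 * π), φ (x, y))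
    (fun x => ?_) a.1
  exact lintegral_congr fun y => hx y x

theorem integral_torus_add_of_periodic {F : ℝ × ℝ → ℂ} (hF : Integrable F torusMeasure)
    (hx : ∀ y, Function.Periodic (fun x => F (x, y)) (2 * π))
    (hy : ∀ x, Function.Periodic (fun y => F (x, y)) (2 * π)) (a : ℝ × ℝ)
    (hFa : Integrable (fun z => F (z + a)) torusMeasure) :
    ∫ z, F (z + a) ∂torusMeasure = ∫ z, F z ∂torusMeasure := by
  have key : ∀ {φ : ℝ → ℂ}, Function.Periodic φ (2 * π) → ∀ b : ℝ,
      ∫ x in Set.Ioc (0 : ℝ) (2 * π), φ (x + b) = ∫ x in Set.Ioc (0 : ℝ) (2 * π), φ x := by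
    intro φ hφ b
    rw [← intervalIntegral.integral_of_le (by positivity),
      ← intervalIntegral.integral_of_le (by positivity), intervalIntegral.integral_comp_add_right,
      add_comm (2 * π), zero_add]
    simpa using hφ.intervalIntegral_add_eq b 0
  rw [torusMeasure] at hF hFa ⊢
  rw [integral_prod _ hFa, integral_prod _ hF]
  have e : ∀ x, ∫ y in Set.Ioc (0 : ℝ) (2 * π), F ((x, y) + a) =
      ∫ y in Set.Ioc (0 : ℝ) (2 * π), F (x + a.1, y) := fun x => key (hy (x + a.1)) a.2
  simp_rw [e]
  refine key (φ := fun x => ∫ y in Set.Ioc (0 : ℝ) (2 * π), F (x, y)) (fun x => ?_) a.1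
  exact integral_congr_ae (Filter.Eventually.of_forall fun y => hx y x)

theorem torusChar_add_right (n : ℤ × ℤ) (z a : ℝ × ℝ) :
    torusChar n (z + a) = torusChar n z * torusChar n a := by
  rw [torusChar, torusChar, torusChar, ← Complex.exp_add]
  congr 1
  push_cast [Prod.fst_add, Prod.snd_add]
  ring

theorem torusChar_mul_neg (n : ℤ × ℤ) (z : ℝ × ℝ) : torusChar n z * torusChar (-n) z = 1 := by
  rw [← torusChar_add, add_neg_cancel]
  simp [torusChar]

theorem torusChar_periodic_fst (n : ℤ × ℤ) (y : ℝ) :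
    Function.Periodic (fun x => torusChar n (x, y)) (2 * π) := by
  intro x
  have h := torusChar_add_right n (x, y) (2 * π, 0)
  have h2 : torusChar n (2 * π, 0) = 1 := by
    rw [torusChar, Complex.exp_eq_one_iff]
    exact ⟨n.1, by push_cast; ring⟩
  rw [h2, mul_one, Prod.mk_add_mk, add_zero] at h
  exact h

theorem torusChar_periodic_snd (n : ℤ × ℤ) (x : ℝ) :
    Function.Periodic (fun y => torusChar n (x, y)) (2 * π) := by
  intro y
  have h := torusChar_add_right n (x, y) (0, 2 * π)
  have h2 : torusChar n (0, 2 * π) = 1 := by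
    rw [torusChar, Complex.exp_eq_one_iff]
    exact ⟨n.2, by push_cast; ring⟩
  rw [h2, mul_one, Prod.mk_add_mk, add_zero] at h
  exact h

/-- The complexification of a function of two real variables. -/
def toComplexFun (f : ℝ → ℝ → ℝ) (z : ℝ × ℝ) : ℂ := (f z.1 z.2 : ℂ)

theorem toComplexFun_periodic_fst {f : ℝ → ℝ → ℝ}
    (hx : ∀ y, Function.Periodic (fun x => f x y) (2 * π)) (y : ℝ) :
    Function.Periodic (fun x => toComplexFun f (x, y)) (2 * π) := fun x =>
  congrArg Complex.ofReal (hx y x)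

theorem toComplexFun_periodic_snd {f : ℝ → ℝ → ℝ}
    (hy : ∀ x, Function.Periodic (f x) (2 * π)) (x : ℝ) :
    Function.Periodic (fun y => toComplexFun f (x, y)) (2 * π) := fun y =>
  congrArg Complex.ofReal (hy x y)

theorem lintegral_enorm_toComplexFun_add {f : ℝ → ℝ → ℝ} (hm : Measurable (Function.uncurry f))
    (hx : ∀ y, Function.Periodic (fun x => f x y) (2 * π))
    (hy : ∀ x, Function.Periodic (f x) (2 * π)) (a : ℝ × ℝ) :
    ∫⁻ z, ‖toComplexFun f (z + a)‖ₑ ∂torusMeasure =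
      ∫⁻ z, ‖toComplexFun f z‖ₑ ∂torusMeasure :=
  lintegral_torus_add_of_periodic (φ := fun z => ‖toComplexFun f z‖ₑ)
    (Complex.measurable_ofReal.comp hm).enorm
    (fun y => (toComplexFun_periodic_fst hx y).comp _)
    (fun x => (toComplexFun_periodic_snd hy x).comp _) a

theorem integrable_toComplexFun_add {f : ℝ → ℝ → ℝ} (hm : Measurable (Function.uncurry f))
    (hx : ∀ y, Function.Periodic (fun x => f x y) (2 * π))
    (hy : ∀ x, Function.Periodic (f x) (2 * π))
    (hf : Integrable (toComplexFun f) torusMeasure) (a : ℝ × ℝ) :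
    Integrable (fun z => toComplexFun f (z + a)) torusMeasure :=
  ⟨((Complex.measurable_ofReal.comp hm).comp (measurable_add_const a)).aestronglyMeasurable,
    (lintegral_enorm_toComplexFun_add hm hx hy a).trans_lt hf.2⟩

theorem torusCoeff_toComplexFun_add {f : ℝ → ℝ → ℝ} (hm : Measurable (Function.uncurry f))
    (hx : ∀ y, Function.Periodic (fun x => f x y) (2 * π))
    (hy : ∀ x, Function.Periodic (f x) (2 * π))
    (hf : Integrable (toComplexFun f) torusMeasure) (a : ℝ × ℝ) (n : ℤ × ℤ) :
    torusCoeff (fun z => toComplexFun f (z + a)) n =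
      torusChar n a * torusCoeff (toComplexFun f) n := by
  have hfa := integrable_toComplexFun_add hm hx hy hf a
  have h := integral_torus_add_of_periodic (integrable_mul_torusChar hf (-n))
    (fun y => (toComplexFun_periodic_fst hx y).mul (torusChar_periodic_fst (-n) y))
    (fun x => (toComplexFun_periodic_snd hy x).mul (torusChar_periodic_snd (-n) x)) a (by
      simp_rw [torusChar_add_right, ← mul_assoc]
      exact (integrable_mul_torusChar hfa (-n)).mul_const _)
  rw [torusCoeff, torusCoeff, ← h, ← integral_const_mul]
  congr 1 with z
  rw [torusChar_add_right]
  linear_combination -(toComplexFun f (z + a) * torusChar (-n) z) * torusChar_mul_neg n a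

/-- The steps entering the mixed difference. -/
def diffStep (α₁ α₂ h₁ h₂ : ℝ) (i : ℕ × ℕ) : ℝ × ℝ := ((α₁ - i.1) * h₁, (α₂ - i.2) * h₂)

/-- The terms of the mixed difference. -/
def diffTerm (α₁ α₂ h₁ h₂ : ℝ) (f : ℝ → ℝ → ℝ) (i : ℕ × ℕ) (z : ℝ × ℝ) : ℂ :=
  (diffCoeff α₁ i.1 * diffCoeff α₂ i.2 : ℝ) * toComplexFun f (z + diffStep α₁ α₂ h₁ h₂ i)

theorem toComplexFun_diff_eq_tsum {α₁ α₂ h₁ h₂ : ℝ} {f : ℝ → ℝ → ℝ} {z : ℝ × ℝ}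
    (h : Summable fun i => ‖diffTerm α₁ α₂ h₁ h₂ f i z‖) :
    toComplexFun (diffX α₁ h₁ (diffY α₂ h₂ f)) z = ∑' i, diffTerm α₁ α₂ h₁ h₂ f i z := by
  let t : ℕ × ℕ → ℝ := fun i => diffCoeff α₁ i.1 * diffCoeff α₂ i.2 *
    f (z.1 + (α₁ - i.1) * h₁) (z.2 + (α₂ - i.2) * h₂)
  have ht : ∀ i, diffTerm α₁ α₂ h₁ h₂ f i z = (t i : ℂ) := fun i => by
    simp only [diffTerm, t, toComplexFun, diffStep]
    push_cast
    rfl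
  simp_rw [ht] at h ⊢
  have hs : Summable t := by
    refine Summable.of_norm ?_
    simpa using h
  rw [← Complex.ofReal_tsum, hs.tsum_prod]
  simp_rw [t, mul_assoc, tsum_mul_left]
  rfl

theorem norm_diffCoeff_mul_exp (α h : ℝ) (n : ℤ) (ν : ℕ) :
    ‖(diffCoeff α ν : ℂ) * Complex.exp (Complex.I * (n * ((α - ν) * h)))‖ = |diffCoeff α ν| := by
  have := Complex.norm_exp_I_mul_ofReal (n * ((α - ν) * h))
  push_cast at this
  rw [norm_mul, Complex.norm_real, Real.norm_eq_abs, this, mul_one]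

theorem diff_integrable_and_torusCoeff {α₁ α₂ : ℝ} (hα₁ : 0 < α₁) (hα₂ : 0 < α₂) (h₁ h₂ : ℝ)
    {f : ℝ → ℝ → ℝ} (hm : Measurable (Function.uncurry f))
    (hx : ∀ y, Function.Periodic (fun x => f x y) (2 * π))
    (hy : ∀ x, Function.Periodic (f x) (2 * π))
    (hf : Integrable (toComplexFun f) torusMeasure) :
    Integrable (toComplexFun (diffX α₁ h₁ (diffY α₂ h₂ f))) torusMeasure ∧
    ∀ n, torusCoeff (toComplexFun (diffX α₁ h₁ (diffY α₂ h₂ f))) n =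
      diffMult α₁ h₁ n.1 * diffMult α₂ h₂ n.2 * torusCoeff (toComplexFun f) n := by
  set T := diffTerm α₁ α₂ h₁ h₂ f with hTdef
  set c : ℕ × ℕ → ℝ := fun i => diffCoeff α₁ i.1 * diffCoeff α₂ i.2 with hc
  have hcs : Summable fun i => |c i| := by
    have := (summable_abs_diffCoeff hα₁).mul_of_nonneg (summable_abs_diffCoeff hα₂)
      (fun _ => abs_nonneg _) (fun _ => abs_nonneg _)
    refine this.congr fun i => ?_
    rw [hc, abs_mul]
  have hTi : ∀ i, Integrable (T i) torusMeasure := fun i =>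
    (integrable_toComplexFun_add hm hx hy hf _).const_mul _
  have hTn : ∀ i, ∫ z, ‖T i z‖ ∂torusMeasure = |c i| * ∫ z, ‖toComplexFun f z‖ ∂torusMeasure := by
    intro i
    simp_rw [hTdef, diffTerm, norm_mul, Complex.norm_real, Real.norm_eq_abs]
    rw [integral_const_mul]
    congr 1
    rw [integral_norm_eq_lintegral_enorm
        (integrable_toComplexFun_add hm hx hy hf _).aestronglyMeasurable,
      integral_norm_eq_lintegral_enorm hf.aestronglyMeasurable,
      lintegral_enorm_toComplexFun_add hm hx hy]
  have hTs : Summable fun i => ∫ z, ‖T i z‖ ∂torusMeasure := by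
    simp_rw [hTn]
    exact hcs.mul_right _
  obtain ⟨hae, hψint⟩ := ae_summable_and_integrable_tsum hTi hTs
  have hG : toComplexFun (diffX α₁ h₁ (diffY α₂ h₂ f)) =ᵐ[torusMeasure] fun z => ∑' i, T i z := by
    filter_upwards [hae] with z hz
    exact toComplexFun_diff_eq_tsum hz
  refine ⟨hψint.congr hG.symm, fun n => ?_⟩
  have e1 : torusCoeff (toComplexFun (diffX α₁ h₁ (diffY α₂ h₂ f))) n =
      ∫ z, ∑' i, T i z * torusChar (-n) z ∂torusMeasure := by
    refine integral_congr_ae ?_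
    filter_upwards [hG] with z hz
    rw [hz, tsum_mul_right]
  have e2 := integral_tsum_of_summable_integral_norm
    (fun i => integrable_mul_torusChar (hTi i) (-n)) (by
      simp_rw [norm_mul, norm_torusChar, mul_one]
      exact hTs)
  have e3 : ∀ i, ∫ z, T i z * torusChar (-n) z ∂torusMeasure =
      ((diffCoeff α₁ i.1 : ℂ) * Complex.exp (Complex.I * (n.1 * ((α₁ - i.1) * h₁)))) *
      ((diffCoeff α₂ i.2 : ℂ) * Complex.exp (Complex.I * (n.2 * ((α₂ - i.2) * h₂)))) *
        torusCoeff (toComplexFun f) n := by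
    intro i
    have h := torusCoeff_toComplexFun_add hm hx hy hf (diffStep α₁ α₂ h₁ h₂ i) n
    rw [torusCoeff] at h
    simp_rw [hTdef, diffTerm, mul_assoc]
    rw [integral_const_mul, h, torusChar_eq_mul]
    simp only [diffStep]
    push_cast
    ring_nf
  rw [e1, ← e2]
  simp_rw [e3]
  rw [tsum_mul_right, diffMult, diffMult, tsum_mul_tsum_of_summable_norm]
  · refine (summable_abs_diffCoeff hα₁).congr fun ν => ?_
    exact (norm_diffCoeff_mul_exp _ _ _ _).symm
  · refine (summable_abs_diffCoeff hα₂).congr fun ν => ?_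
    exact (norm_diffCoeff_mul_exp _ _ _ _).symm

theorem Lp2Norm_eq_eLpNorm {p : ℝ} (hp : 1 ≤ p) {g : ℝ → ℝ → ℝ}
    (hg : AEStronglyMeasurable (toComplexFun g) torusMeasure) :
    Lp2Norm p g = eLpNorm (toComplexFun g) (ENNReal.ofReal p) torusMeasure := by
  have hp0 : 0 < p := by linarith
  rw [eLpNorm_eq_lintegral_rpow_enorm_toReal (by simpa using hp0) ENNReal.ofReal_ne_top,
    ENNReal.toReal_ofReal hp0.le, Lp2Norm]
  congr 1
  rw [torusMeasure, lintegral_prod _ (hg.enorm.pow_const p)]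
  refine lintegral_congr fun x => lintegral_congr fun y => ?_
  rw [← ofReal_norm, ENNReal.ofReal_rpow_of_nonneg (norm_nonneg _) hp0.le]
  simp [toComplexFun]

theorem MemLp0.integrable {p : ℝ} (hp : 1 ≤ p) {f : ℝ → ℝ → ℝ} (hf : MemLp0 p f) :
    Integrable (toComplexFun f) torusMeasure := by
  have hm : AEStronglyMeasurable (toComplexFun f) torusMeasure :=
    (Complex.measurable_ofReal.comp hf.meas).aestronglyMeasurable
  have : MemLp (toComplexFun f) (ENNReal.ofReal p) torusMeasure := by
    refine ⟨hm, ?_⟩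
    rw [← Lp2Norm_eq_eLpNorm hp hm]
    exact hf.norm_ne_top.lt_top
  exact this.integrable (ENNReal.one_le_ofReal.2 hp)

theorem torusCoeff_eq_integral_real {f : ℝ → ℝ → ℝ} (hf : Integrable (toComplexFun f) torusMeasure)
    {u v : ℝ → ℝ} (hu : Continuous u) (hv : Continuous v) (hu1 : ∀ x, |u x| ≤ 1)
    (hv1 : ∀ x, |v x| ≤ 1) :
    Integrable (fun z : ℝ × ℝ => toComplexFun f z * (u z.1 * v z.2)) torusMeasure ∧
    ∫ z, toComplexFun f z * (u z.1 * v z.2) ∂torusMeasure =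
      ((∫ x in (0:ℝ)..(2*π), ∫ y in (0:ℝ)..(2*π), f x y * u x * v y : ℝ) : ℂ) := by
  have hi : Integrable (fun z : ℝ × ℝ => toComplexFun f z * (u z.1 * v z.2)) torusMeasure := by
    refine hf.mul_bdd (c := 1) (by fun_prop) (Filter.Eventually.of_forall fun z => ?_)
    rw [norm_mul, Complex.norm_real, Complex.norm_real, Real.norm_eq_abs, Real.norm_eq_abs]
    exact mul_le_one₀ (hu1 _) (abs_nonneg _) (hv1 _)
  refine ⟨hi, ?_⟩
  rw [torusMeasure] at hi ⊢
  rw [integral_prod _ hi, intervalIntegral.integral_of_le (by positivity),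
    ← integral_complex_ofReal]
  refine integral_congr_ae (Filter.Eventually.of_forall fun x => ?_)
  simp only []
  rw [intervalIntegral.integral_of_le (by positivity), ← integral_complex_ofReal]
  refine integral_congr_ae (Filter.Eventually.of_forall fun y => ?_)
  simp only [toComplexFun]
  push_cast
  ring

theorem integral_add_three_mul {Ω : Type*} [MeasurableSpace Ω] {μ : Measure Ω}
    {g₁ g₂ g₃ g₄ : Ω → ℂ} (i₁ : Integrable g₁ μ) (i₂ : Integrable g₂ μ) (i₃ : Integrable g₃ μ)
    (i₄ : Integrable g₄ μ) (c₂ c₃ c₄ : ℂ) :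
    ∫ z, g₁ z + c₂ * g₂ z + c₃ * g₃ z + c₄ * g₄ z ∂μ =
      (∫ z, g₁ z ∂μ) + c₂ * (∫ z, g₂ z ∂μ) + c₃ * (∫ z, g₃ z ∂μ) + c₄ * ∫ z, g₄ z ∂μ := by
  have j₂ := i₁.add (i₂.const_mul c₂)
  have j₃ := j₂.add (i₃.const_mul c₃)
  have s₂ := integral_add i₁ (i₂.const_mul c₂)
  have s₃ := integral_add j₂ (i₃.const_mul c₃)
  have s₄ := integral_add j₃ (i₄.const_mul c₄)
  rw [integral_const_mul] at s₂ s₃ s₄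
  simp only [Pi.add_apply] at s₃ s₄
  rw [s₄, s₃, s₂]

theorem torusCoeff_eq_fourierCC {f : ℝ → ℝ → ℝ} (hf : Integrable (toComplexFun f) torusMeasure)
    (h0 : ∀ n₁ n₂ : ℕ, fourierSC f n₁ n₂ = 0 ∧ fourierCS f n₁ n₂ = 0 ∧ fourierSS f n₁ n₂ = 0)
    (n : ℤ × ℤ) :
    torusCoeff (toComplexFun f) n = (π ^ 2 * fourierCC f n.1.natAbs n.2.natAbs : ℝ) := by
  have hab : ∀ k : ℤ, ((k.natAbs : ℕ) : ℝ) = |(k : ℝ)| := fun k => by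
    rw [Nat.cast_natAbs, Int.cast_abs]
  have hcos : ∀ (k : ℤ) (x : ℝ), Real.cos (k * x) = Real.cos (k.natAbs * x) := fun k x => by
    rw [hab]
    rcases abs_choice (k : ℝ) with h | h <;> rw [h]
    rw [neg_mul, Real.cos_neg]
  have hsin : ∀ k : ℤ, ∃ ε : ℝ, ∀ x : ℝ, Real.sin (k * x) = ε * Real.sin (k.natAbs * x) :=
    fun k => by
      rw [hab]
      rcases abs_choice (k : ℝ) with h | h <;> rw [h]
      · exact ⟨1, fun x => by rw [one_mul]⟩
      · exact ⟨-1, fun x => by rw [neg_mul (k : ℝ), Real.sin_neg]; ring⟩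
  obtain ⟨ε, hε⟩ := hsin n.1
  obtain ⟨η, hη⟩ := hsin n.2
  set a := n.1.natAbs
  set b := n.2.natAbs
  have cc (k : ℕ) : Continuous fun x : ℝ => Real.cos (k * x) := by fun_prop
  have cs (k : ℕ) : Continuous fun x : ℝ => Real.sin (k * x) := by fun_prop
  have bc (k : ℕ) (x : ℝ) : |Real.cos (k * x)| ≤ 1 := Real.abs_cos_le_one _
  have bs (k : ℕ) (x : ℝ) : |Real.sin (k * x)| ≤ 1 := Real.abs_sin_le_one _
  obtain ⟨i1, e1⟩ := torusCoeff_eq_integral_real hf (cc a) (cc b) (bc a) (bc b)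
  obtain ⟨i2, e2⟩ := torusCoeff_eq_integral_real hf (cs a) (cc b) (bs a) (bc b)
  obtain ⟨i3, e3⟩ := torusCoeff_eq_integral_real hf (cc a) (cs b) (bc a) (bs b)
  obtain ⟨i4, e4⟩ := torusCoeff_eq_integral_real hf (cs a) (cs b) (bs a) (bs b)
  have hpi : (1 / π ^ 2) ≠ 0 := by positivity
  obtain ⟨z2, z3, z4⟩ := h0 a b
  rw [fourierSC, mul_eq_zero_iff_left hpi] at z2
  rw [fourierCS, mul_eq_zero_iff_left hpi] at z3
  rw [fourierSS, mul_eq_zero_iff_left hpi] at z4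
  rw [z2] at e2
  rw [z3] at e3
  rw [z4] at e4
  have key : ∀ z : ℝ × ℝ, toComplexFun f z * torusChar (-n) z =
      toComplexFun f z * ((Real.cos (a * z.1) : ℂ) * (Real.cos (b * z.2) : ℂ)) +
      (-Complex.I * ε) * (toComplexFun f z *
        ((Real.sin (a * z.1) : ℂ) * (Real.cos (b * z.2) : ℂ))) +
      (-Complex.I * η) * (toComplexFun f z *
        ((Real.cos (a * z.1) : ℂ) * (Real.sin (b * z.2) : ℂ))) +
      (-(ε * η)) * (toComplexFun f z * ((Real.sin (a * z.1) : ℂ) * (Real.sin (b * z.2) : ℂ))) := by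
    intro z
    have hE : ∀ (k : ℤ) (x : ℝ), Complex.exp (((-k : ℤ) * Complex.I) * x) =
        (Real.cos (k * x) : ℂ) - (Real.sin (k * x) : ℂ) * Complex.I := by
      intro k x
      rw [show ((-k : ℤ) * Complex.I) * (x : ℂ) = ((-(k * x) : ℝ) : ℂ) * Complex.I by
        push_cast; ring, Complex.exp_mul_I, ← Complex.ofReal_cos, ← Complex.ofReal_sin,
        Real.cos_neg, Real.sin_neg]
      push_cast
      ring
    rw [torusChar_eq_mul, Prod.fst_neg, Prod.snd_neg, hE, hE, hε, hη, hcos, hcos]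
    push_cast
    linear_combination (toComplexFun f z * ε * η * Complex.sin (a * z.1) *
      Complex.sin (b * z.2)) * Complex.I_sq
  rw [torusCoeff]
  simp_rw [key]
  rw [integral_add_three_mul i1 i2 i3 i4, e1, e2, e3, e4, fourierCC]
  rw [← mul_assoc, mul_one_div_cancel (by positivity), one_mul]
  simp

/-- Weighted square sums of a double sequence. -/
def lacSum (lam : ℕ → ℕ → ℝ) (w₁ w₂ : ℕ → ℝ) : ℝ≥0∞ :=
  ∑' i : ℕ × ℕ, ENNReal.ofReal ((lam i.1 i.2 * w₁ i.1 * w₂ i.2) ^ 2)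

theorem lacSum_le {lam : ℕ → ℕ → ℝ} {w₁ w₂ v₁ v₂ : ℕ → ℝ} {k₁ k₂ : ℝ}
    (h₁ : ∀ μ, |w₁ μ| ≤ k₁ * |v₁ μ|) (h₂ : ∀ μ, |w₂ μ| ≤ k₂ * |v₂ μ|) :
    lacSum lam w₁ w₂ ≤ ENNReal.ofReal ((k₁ * k₂) ^ 2) * lacSum lam v₁ v₂ := by
  rw [lacSum, lacSum, ← ENNReal.tsum_mul_left]
  refine ENNReal.tsum_le_tsum fun i => ?_
  rw [← ENNReal.ofReal_mul (sq_nonneg _)]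
  refine ENNReal.ofReal_le_ofReal ?_
  rw [← mul_pow, sq_le_sq]
  have h : |w₁ i.1| * |w₂ i.2| ≤ (k₁ * |v₁ i.1|) * (k₂ * |v₂ i.2|) :=
    mul_le_mul (h₁ _) (h₂ _) (abs_nonneg _) ((abs_nonneg _).trans (h₁ _))
  calc |lam i.1 i.2 * w₁ i.1 * w₂ i.2| = |lam i.1 i.2| * (|w₁ i.1| * |w₂ i.2|) := by
        rw [abs_mul, abs_mul, mul_assoc]
    _ ≤ |lam i.1 i.2| * ((k₁ * |v₁ i.1|) * (k₂ * |v₂ i.2|)) :=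
        mul_le_mul_of_nonneg_left h (abs_nonneg _)
    _ = k₁ * k₂ * |lam i.1 i.2 * v₁ i.1 * v₂ i.2| := by
        rw [abs_mul, abs_mul]
        ring
    _ ≤ |k₁ * k₂ * (lam i.1 i.2 * v₁ i.1 * v₂ i.2)| := by
        rw [abs_mul (k₁ * k₂)]
        exact mul_le_mul_of_nonneg_right (le_abs_self _) (abs_nonneg _)

/-- The size of the multiplier of the difference of order `α` at the frequency `2 ^ μ`. -/
def sinWeight (α h : ℝ) (μ : ℕ) : ℝ := |2 * Real.sin (2 ^ μ * h / 2)| ^ α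

/-- The extremal size of `sinWeight α h` over `|h| ≤ δ`, up to constants. -/
def minWeight (α δ : ℝ) (μ : ℕ) : ℝ := min 1 (2 ^ μ * δ) ^ α

theorem natAbs_boolSign_mul (b : Bool) (μ : ℕ) : (boolSign b * 2 ^ μ).natAbs = 2 ^ μ := by
  rw [Int.natAbs_mul, Int.natAbs_pow]
  cases b <;> simp [boolSign]

theorem exists_boolSign_mul_eq {k : ℤ} {μ : ℕ} (h : k.natAbs = 2 ^ μ) :
    ∃ b, boolSign b * 2 ^ μ = k := by
  rcases Int.natAbs_eq k with hk | hk
  · exact ⟨true, by rw [hk, h]; simp [boolSign]⟩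
  · exact ⟨false, by rw [hk, h]; simp [boolSign]⟩

theorem InLambdaClass.torusCoeff_eq_zero {p : ℝ} (hp : 1 < p) {f : ℝ → ℝ → ℝ} {lam : ℕ → ℕ → ℝ}
    (hf : InLambdaClass p f lam) {n : ℤ × ℤ} (hn : n ∉ Set.range lacFreq) :
    torusCoeff (toComplexFun f) n = 0 := by
  rw [torusCoeff_eq_fourierCC (hf.1.integrable hp.le) hf.2.2.2, hf.2.2.1 _ _ ?_]
  · simp
  · rintro ⟨a, b, ha, hb⟩
    obtain ⟨s, hs⟩ := exists_boolSign_mul_eq ha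
    obtain ⟨t, ht⟩ := exists_boolSign_mul_eq hb
    exact hn ⟨((a, b), (s, t)), Prod.ext hs ht⟩

theorem InLambdaClass.torusCoeff_lacFreq {p : ℝ} (hp : 1 < p) {f : ℝ → ℝ → ℝ} {lam : ℕ → ℕ → ℝ}
    (hf : InLambdaClass p f lam) (i : (ℕ × ℕ) × (Bool × Bool)) :
    torusCoeff (toComplexFun f) (lacFreq i) = (π ^ 2 * lam i.1.1 i.1.2 : ℝ) := by
  rw [torusCoeff_eq_fourierCC (hf.1.integrable hp.le) hf.2.2.2, lacFreq, natAbs_boolSign_mul,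
    natAbs_boolSign_mul, hf.2.1]

theorem InLambdaClass.tsum_torusCoeff_diff {p : ℝ} (hp : 1 < p) {f : ℝ → ℝ → ℝ}
    {lam : ℕ → ℕ → ℝ} (hf : InLambdaClass p f lam) {α₁ α₂ : ℝ} (hα₁ : 0 < α₁) (hα₂ : 0 < α₂)
    (h₁ h₂ : ℝ) :
    ∑' i, ‖torusCoeff (toComplexFun (diffX α₁ h₁ (diffY α₂ h₂ f))) (lacFreq i)‖ₑ ^ 2 =
      ENNReal.ofReal (4 * π ^ 4) * lacSum lam (sinWeight α₁ h₁) (sinWeight α₂ h₂) := by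
  have hd := (diff_integrable_and_torusCoeff hα₁ hα₂ h₁ h₂ hf.1.meas hf.1.periodic_x
    hf.1.periodic_y (hf.1.integrable hp.le)).2
  have e : ∀ i, ‖torusCoeff (toComplexFun (diffX α₁ h₁ (diffY α₂ h₂ f))) (lacFreq i)‖ₑ ^ 2 =
      ENNReal.ofReal (π ^ 4 * (lam i.1.1 i.1.2 * sinWeight α₁ h₁ i.1.1 *
        sinWeight α₂ h₂ i.1.2) ^ 2) := by
    intro i
    rw [hd, hf.torusCoeff_lacFreq hp, ← ofReal_norm, ← ENNReal.ofReal_pow (norm_nonneg _), norm_mul,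
      norm_mul, Complex.norm_real,
      norm_diffMult_eq_of_natAbs hα₁ _ (n := (lacFreq i).1) (natAbs_boolSign_mul _ _),
      norm_diffMult_eq_of_natAbs hα₂ _ (n := (lacFreq i).2) (natAbs_boolSign_mul _ _),
      mul_pow, Real.norm_eq_abs, sq_abs]
    congr 1
    simp only [sinWeight]
    ring
  simp_rw [e]
  rw [ENNReal.tsum_prod (f := fun (j : ℕ × ℕ) (_ : Bool × Bool) => ENNReal.ofReal
    (π ^ 4 * (lam j.1 j.2 * sinWeight α₁ h₁ j.1 * sinWeight α₂ h₂ j.2) ^ 2)),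
    lacSum, ← ENNReal.tsum_mul_left]
  refine tsum_congr fun i => ?_
  simp only [tsum_fintype, Finset.sum_const, Finset.card_univ, Fintype.card_prod, Fintype.card_bool]
  rw [nsmul_eq_mul, ← ENNReal.ofReal_natCast, ← ENNReal.ofReal_mul (by positivity),
    ← ENNReal.ofReal_mul (by positivity)]
  congr 1
  push_cast
  ring

theorem exists_Lp2Norm_diff_equiv {p : ℝ} (hp : 1 < p) :
    ∃ C : ℝ, 0 < C ∧ ∀ (f : ℝ → ℝ → ℝ) (lam : ℕ → ℕ → ℝ), InLambdaClass p f lam →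
      ∀ α₁ α₂ : ℝ, 0 < α₁ → 0 < α₂ → ∀ h₁ h₂ : ℝ,
        Lp2Norm p (diffX α₁ h₁ (diffY α₂ h₂ f)) ^ 2 ≤
          ENNReal.ofReal C * lacSum lam (sinWeight α₁ h₁) (sinWeight α₂ h₂) ∧
        lacSum lam (sinWeight α₁ h₁) (sinWeight α₂ h₂) ≤
          ENNReal.ofReal C * Lp2Norm p (diffX α₁ h₁ (diffY α₂ h₂ f)) ^ 2 := by
  obtain ⟨C₁, hC₁, H₁⟩ := exists_tsum_torusCoeff_sq_le hp
  obtain ⟨C₂, hC₂, H₂⟩ := exists_eLpNorm_sq_le_tsum_torusCoeff hp.le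
  refine ⟨max C₁ (C₂ * (4 * π ^ 4)), lt_max_of_lt_left hC₁,
    fun f lam hf α₁ α₂ hα₁ hα₂ h₁ h₂ => ?_⟩
  obtain ⟨hi, hd⟩ := diff_integrable_and_torusCoeff hα₁ hα₂ h₁ h₂ hf.1.meas hf.1.periodic_x
    hf.1.periodic_y (hf.1.integrable hp.le)
  have e := hf.tsum_torusCoeff_diff hp hα₁ hα₂ h₁ h₂
  rw [Lp2Norm_eq_eLpNorm hp.le hi.aestronglyMeasurable]
  have g₁ := H₁ _ hi
  have g₂ := H₂ _ hi fun n hn => by rw [hd, hf.torusCoeff_eq_zero hp hn, mul_zero]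
  rw [e] at g₁ g₂
  constructor
  · refine g₂.trans ?_
    rw [← mul_assoc, ← ENNReal.ofReal_mul hC₂.le]
    exact mul_le_mul_left (ENNReal.ofReal_le_ofReal (le_max_right _ _)) _
  · have hpi : (1 : ℝ) ≤ 4 * π ^ 4 := by
      have : (1 : ℝ) ≤ π ^ 4 := one_le_pow₀ (by linarith [pi_gt_three])
      linarith
    refine (le_mul_of_one_le_left zero_le (ENNReal.one_le_ofReal.2 hpi)).trans (g₁.trans ?_)
    exact mul_le_mul_left (ENNReal.ofReal_le_ofReal (le_max_left _ _)) _

theorem sinWeight_nonneg (α h : ℝ) (μ : ℕ) : 0 ≤ sinWeight α h μ := by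
  unfold sinWeight
  positivity

theorem minWeight_nonneg (α : ℝ) {δ : ℝ} (hδ : 0 ≤ δ) (μ : ℕ) : 0 ≤ minWeight α δ μ := by
  unfold minWeight
  positivity

theorem sinWeight_le {α : ℝ} (hα : 0 ≤ α) {h δ : ℝ} (hh : |h| ≤ δ) (μ : ℕ) :
    |sinWeight α h μ| ≤ 2 ^ α * |minWeight α δ μ| := by
  have hδ : 0 ≤ δ := (abs_nonneg h).trans hh
  rw [abs_of_nonneg (sinWeight_nonneg _ _ _), abs_of_nonneg (minWeight_nonneg _ hδ _), sinWeight,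
    minWeight, ← Real.mul_rpow (by norm_num) (by positivity)]
  refine Real.rpow_le_rpow (abs_nonneg _) ?_ hα
  rw [mul_min_of_nonneg _ _ (by norm_num), abs_mul, abs_two]
  refine le_min (mul_le_mul_of_nonneg_left (Real.abs_sin_le_one _) (by norm_num)) ?_
  refine mul_le_mul_of_nonneg_left ?_ (by norm_num)
  refine Real.abs_sin_le_abs.trans ?_
  rw [abs_div, abs_mul, abs_two, abs_of_nonneg (by positivity : (0 : ℝ) ≤ 2 ^ μ)]
  have : (2 : ℝ) ^ μ * |h| ≤ 2 ^ μ * δ := mul_le_mul_of_nonneg_left hh (by positivity)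
  have : 0 ≤ (2 : ℝ) ^ μ * δ := by positivity
  linarith

theorem sin_sq_two_pow_mul_pi_div_three (i : ℕ) : Real.sin (2 ^ i * (π / 3)) ^ 2 = 3 / 4 := by
  induction i with
  | zero =>
    rw [pow_zero, one_mul, Real.sin_pi_div_three, div_pow, Real.sq_sqrt (by norm_num)]
    norm_num
  | succ i ih =>
    rw [pow_succ' 2 i, mul_assoc, Real.sin_two_mul, mul_pow, Real.cos_sq', mul_pow, ih]
    norm_num

theorem exists_minWeight_le {δ : ℝ} (hδ : 0 < δ) (hδ1 : δ < 1) :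
    ∃ h : ℝ, |h| ≤ δ ∧ ∀ α : ℝ, 0 ≤ α → ∀ μ, |minWeight α δ μ| ≤ 4 ^ α * |sinWeight α h μ| := by
  obtain ⟨n, hn1, hn2⟩ := exists_nat_pow_near_of_lt_one (x := 3 * δ / (2 * π)) (y := 1 / 2)
    (by positivity) (by rw [div_le_one (by positivity)]; linarith [pi_gt_three]) (by norm_num)
    (by norm_num)
  set h : ℝ := 2 * π / 3 * (1 / 2) ^ (n + 1) with hh
  have hpos : 0 < h := by positivity
  have hhδ : h ≤ δ := by
    rw [lt_div_iff₀ (by positivity)] at hn1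
    rw [hh]
    linarith
  have hδh : δ ≤ 2 * h := by
    rw [div_le_iff₀ (by positivity)] at hn2
    rw [hh, pow_succ]
    linarith
  refine ⟨h, by rwa [abs_of_pos hpos], fun α hα μ => ?_⟩
  rw [abs_of_nonneg (sinWeight_nonneg _ _ _), abs_of_nonneg (minWeight_nonneg _ hδ.le _), sinWeight,
    minWeight, ← Real.mul_rpow (by norm_num) (by positivity)]
  refine Real.rpow_le_rpow (by positivity) ?_ hα
  rcases le_or_gt (n + 1) μ with hμ | hμ
  · obtain ⟨i, rfl⟩ := Nat.exists_eq_add_of_le hμ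
    have e : 2 ^ (n + 1 + i) * h / 2 = 2 ^ i * (π / 3) := by
      rw [hh, pow_add, div_pow, one_pow]
      field_simp
    have h1 : 1 ≤ |2 * Real.sin (2 ^ i * (π / 3))| := by
      rw [← one_le_sq_iff_one_le_abs, mul_pow, sin_sq_two_pow_mul_pi_div_three]
      norm_num
    rw [e]
    linarith [min_le_left 1 (2 ^ (n + 1 + i) * δ)]
  · have hx0 : 0 ≤ 2 ^ μ * h / 2 := by positivity
    have h2 : (2 : ℝ) ^ μ * (1 / 2) ^ (n + 1) ≤ 1 := by
      rw [div_pow, one_pow, mul_one_div, div_le_one (by positivity)]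
      exact pow_le_pow_right₀ (by norm_num) hμ.le
    have hx1 : 2 ^ μ * h / 2 ≤ π / 2 := by
      have : 2 ^ μ * h = 2 * π / 3 * ((2 : ℝ) ^ μ * (1 / 2) ^ (n + 1)) := by rw [hh]; ring
      rw [this]
      nlinarith [pi_pos]
    have h3 := Real.mul_le_sin hx0 hx1
    have h4 : (2 : ℝ) ^ μ * δ ≤ 2 ^ μ * (2 * h) := mul_le_mul_of_nonneg_left hδh (by positivity)
    have h5 : 1 / 2 ≤ 2 / π := by
      rw [div_le_div_iff₀ (by norm_num) pi_pos]
      linarith [pi_lt_four]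
    have h6 : 1 / 2 * (2 ^ μ * h / 2) ≤ 2 / π * (2 ^ μ * h / 2) :=
      mul_le_mul_of_nonneg_right h5 hx0
    have h7 := le_abs_self (2 * Real.sin (2 ^ μ * h / 2))
    linarith [min_le_right 1 (2 ^ μ * δ)]

theorem exists_mixedMod_equiv {p : ℝ} (hp : 1 < p) {α₁ α₂ : ℝ} (hα₁ : 0 < α₁) (hα₂ : 0 < α₂) :
    ∃ C : ℝ, 0 < C ∧ ∀ (f : ℝ → ℝ → ℝ) (lam : ℕ → ℕ → ℝ), InLambdaClass p f lam →
      ∀ δ₁ δ₂ : ℝ, δ₁ ∈ Set.Ioo (0 : ℝ) 1 → δ₂ ∈ Set.Ioo (0 : ℝ) 1 →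
        mixedMod p α₁ α₂ δ₁ δ₂ f ^ 2 ≤
          ENNReal.ofReal C * lacSum lam (minWeight α₁ δ₁) (minWeight α₂ δ₂) ∧
        lacSum lam (minWeight α₁ δ₁) (minWeight α₂ δ₂) ≤
          ENNReal.ofReal C * mixedMod p α₁ α₂ δ₁ δ₂ f ^ 2 := by
  obtain ⟨C, hC, H⟩ := exists_Lp2Norm_diff_equiv hp
  refine ⟨(4 ^ α₁ * 4 ^ α₂) ^ 2 * C, by positivity, fun f lam hf δ₁ δ₂ hδ₁ hδ₂ => ⟨?_, ?_⟩⟩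
  · set B := ENNReal.ofReal ((4 ^ α₁ * 4 ^ α₂) ^ 2 * C) *
      lacSum lam (minWeight α₁ δ₁) (minWeight α₂ δ₂)
    have hB : mixedMod p α₁ α₂ δ₁ δ₂ f ≤ B ^ (2⁻¹ : ℝ) := by
      refine iSup₂_le fun h₁ hh₁ => iSup₂_le fun h₂ hh₂ => ?_
      rw [ENNReal.le_rpow_inv_iff two_pos, ENNReal.rpow_two]
      refine (H f lam hf α₁ α₂ hα₁ hα₂ h₁ h₂).1.trans ?_
      have := lacSum_le (lam := lam) (sinWeight_le hα₁.le hh₁) (sinWeight_le hα₂.le hh₂)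
      refine (mul_le_mul_right this _).trans ?_
      rw [← mul_assoc, ← ENNReal.ofReal_mul hC.le, mul_comm C]
      refine mul_le_mul_left (ENNReal.ofReal_le_ofReal ?_) _
      gcongr <;> norm_num
    rw [← ENNReal.rpow_two]
    exact (ENNReal.le_rpow_inv_iff two_pos).1 hB
  · obtain ⟨h₁, hh₁, hw₁⟩ := exists_minWeight_le hδ₁.1 hδ₁.2
    obtain ⟨h₂, hh₂, hw₂⟩ := exists_minWeight_le hδ₂.1 hδ₂.2
    refine (lacSum_le (hw₁ α₁ hα₁.le) (hw₂ α₂ hα₂.le)).trans ?_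
    rw [ENNReal.ofReal_mul (by positivity), mul_assoc]
    refine mul_le_mul_right ((H f lam hf α₁ α₂ hα₁ hα₂ h₁ h₂).2.trans ?_) _
    refine mul_le_mul_right (pow_le_pow_left₀ zero_le ?_ 2) _
    exact le_iSup₂_of_le h₁ hh₁ (le_iSup₂_of_le h₂ hh₂ le_rfl)

/-- The density `t ^ (-2α-1) min(1, 2 ^ μ t) ^ (2β)`. -/
def marchaudDensity (α β : ℝ) (μ : ℕ) (t : ℝ) : ℝ≥0∞ :=
  ENNReal.ofReal (t ^ (-2 * α - 1) * minWeight β t μ ^ 2)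

theorem measurable_minWeight (α : ℝ) (μ : ℕ) : Measurable fun t => minWeight α t μ := by
  unfold minWeight
  exact (measurable_const.min (measurable_const.mul measurable_id)).pow_const _

theorem measurable_marchaudDensity (α β : ℝ) (μ : ℕ) : Measurable (marchaudDensity α β μ) := by
  unfold marchaudDensity
  exact ((measurable_id.pow_const _).mul ((measurable_minWeight β μ).pow_const 2)).ennreal_ofReal

theorem minWeight_sq {α δ : ℝ} (hδ : 0 ≤ δ) (μ : ℕ) :
    minWeight α δ μ ^ 2 = min 1 (2 ^ μ * δ) ^ (2 * α) := by
  rw [minWeight, ← Real.rpow_natCast, ← Real.rpow_mul (by positivity), mul_comm α]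
  norm_num

theorem lintegral_Ioi_rpow {α c : ℝ} (hα : 0 < α) (hc : 0 < c) :
    ∫⁻ t in Set.Ioi c, ENNReal.ofReal (t ^ (-2 * α - 1)) =
      ENNReal.ofReal (c ^ (-2 * α) / (2 * α)) := by
  rw [← ofReal_integral_eq_lintegral_ofReal (integrableOn_Ioi_rpow_of_lt (by linarith) hc),
    integral_Ioi_rpow_of_lt (by linarith) hc]
  · congr 1
    rw [sub_add_cancel]
    field_simp
  · filter_upwards [ae_restrict_mem measurableSet_Ioi] with t ht
    exact Real.rpow_nonneg (hc.trans ht).le _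

theorem lintegral_Ioc_rpow {γ c : ℝ} (hγ : 0 < γ) (hc : 0 < c) :
    ∫⁻ t in Set.Ioc 0 c, ENNReal.ofReal (t ^ (γ - 1)) = ENNReal.ofReal (c ^ γ / γ) := by
  have hi := (intervalIntegral.intervalIntegrable_rpow' (a := 0) (b := c)
    (by linarith : -1 < γ - 1)).1
  rw [← ofReal_integral_eq_lintegral_ofReal hi,
    ← intervalIntegral.integral_of_le hc.le, integral_rpow (Or.inl (by linarith))]
  · rw [sub_add_cancel, Real.zero_rpow hγ.ne', sub_zero]
  · filter_upwards [ae_restrict_mem measurableSet_Ioc] with t ht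
    exact Real.rpow_nonneg ht.1.le _

theorem lintegral_marchaudDensity_le {α β : ℝ} (hα : 0 < α) (hαβ : α < β) {δ : ℝ} (hδ : 0 < δ)
    (μ : ℕ) :
    ENNReal.ofReal (δ ^ (2 * α)) * ∫⁻ t in Set.Ioo δ 1, marchaudDensity α β μ t ≤
      ENNReal.ofReal ((1 / (2 * α) + 1 / (2 * (β - α))) * minWeight α δ μ ^ 2) := by
  have hβ : 0 < β := hα.trans hαβ
  have hγ : 0 < 2 * (β - α) := by linarith
  have hN : (0 : ℝ) < 2 ^ μ := by positivity
  have hle1 : ∀ t : ℝ, 0 < t → marchaudDensity α β μ t ≤ ENNReal.ofReal (t ^ (-2 * α - 1)) := by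
    intro t ht
    refine ENNReal.ofReal_le_ofReal (mul_le_of_le_one_right (by positivity) ?_)
    rw [minWeight_sq ht.le]
    exact Real.rpow_le_one (by positivity) (min_le_left _ _) (by linarith)
  rw [minWeight_sq hδ.le]
  rcases le_total 1 (2 ^ μ * δ) with h1 | h1
  · rw [min_eq_left h1, Real.one_rpow, mul_one]
    have hJ : ∫⁻ t in Set.Ioo δ 1, marchaudDensity α β μ t ≤
        ENNReal.ofReal (δ ^ (-2 * α) / (2 * α)) := by
      rw [← lintegral_Ioi_rpow hα hδ]
      refine (setLIntegral_mono' measurableSet_Ioo fun t ht => hle1 t (hδ.trans ht.1)).trans ?_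
      exact lintegral_mono_set Set.Ioo_subset_Ioi_self
    refine (mul_le_mul_right hJ _).trans ?_
    rw [← ENNReal.ofReal_mul (by positivity)]
    refine ENNReal.ofReal_le_ofReal ?_
    rw [mul_div_assoc', ← Real.rpow_add hδ, neg_mul, add_neg_cancel, Real.rpow_zero]
    have : 0 < 1 / (2 * (β - α)) := by positivity
    linarith
  · rw [min_eq_right h1]
    set c : ℝ := (2 ^ μ)⁻¹ with hc
    have hc0 : 0 < c := by positivity
    have hle2 : ∀ t : ℝ, 0 < t → marchaudDensity α β μ t ≤
        ENNReal.ofReal ((2 ^ μ) ^ (2 * β)) * ENNReal.ofReal (t ^ (2 * (β - α) - 1)) := by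
      intro t ht
      rw [← ENNReal.ofReal_mul (by positivity)]
      refine ENNReal.ofReal_le_ofReal ?_
      rw [minWeight_sq ht.le]
      calc t ^ (-2 * α - 1) * min 1 (2 ^ μ * t) ^ (2 * β)
          ≤ t ^ (-2 * α - 1) * (2 ^ μ * t) ^ (2 * β) := by
            refine mul_le_mul_of_nonneg_left ?_ (by positivity)
            exact Real.rpow_le_rpow (by positivity) (min_le_right _ _) (by linarith)
        _ = (2 ^ μ) ^ (2 * β) * (t ^ (-2 * α - 1) * t ^ (2 * β)) := by
            rw [Real.mul_rpow hN.le ht.le]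
            ring
        _ = (2 ^ μ) ^ (2 * β) * t ^ (2 * (β - α) - 1) := by
            rw [← Real.rpow_add ht]
            ring_nf
    have hJ : ∫⁻ t in Set.Ioo δ 1, marchaudDensity α β μ t ≤
        ENNReal.ofReal ((2 ^ μ) ^ (2 * β)) * ENNReal.ofReal (c ^ (2 * (β - α)) / (2 * (β - α))) +
          ENNReal.ofReal (c ^ (-2 * α) / (2 * α)) := by
      rw [← lintegral_Ioi_rpow hα hc0, ← lintegral_Ioc_rpow hγ hc0,
        ← lintegral_const_mul' _ _ ENNReal.ofReal_ne_top]
      have hsub : Set.Ioo δ 1 ⊆ Set.Ioc 0 c ∪ Set.Ioi c := by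
        intro t ht
        rcases le_or_gt t c with h | h
        · exact Or.inl ⟨hδ.trans ht.1, h⟩
        · exact Or.inr h
      refine (lintegral_mono_set hsub).trans ((lintegral_union_le _ _ _).trans ?_)
      exact add_le_add
        (setLIntegral_mono' measurableSet_Ioc fun t ht => hle2 t ht.1)
        (setLIntegral_mono' measurableSet_Ioi fun t ht => hle1 t (hc0.trans ht))
    refine (mul_le_mul_right hJ _).trans ?_
    rw [← ENNReal.ofReal_mul (by positivity), ← ENNReal.ofReal_add (by positivity) (by positivity),
      ← ENNReal.ofReal_mul (by positivity)]
    refine ENNReal.ofReal_le_ofReal (le_of_eq ?_)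
    have e1 : ((2 : ℝ) ^ μ) ^ (2 * β) * c ^ (2 * (β - α)) = (2 ^ μ) ^ (2 * α) := by
      rw [hc, Real.inv_rpow hN.le, ← Real.rpow_neg hN.le, ← Real.rpow_add hN]
      ring_nf
    have e2 : c ^ (-2 * α) = (2 ^ μ) ^ (2 * α) := by
      rw [hc, Real.inv_rpow hN.le, ← Real.rpow_neg hN.le]
      ring_nf
    rw [mul_div_assoc', e1, e2, Real.mul_rpow hN.le hδ.le]
    ring

theorem le_lintegral_marchaudDensity {α β : ℝ} (hα : 0 < α) (hβ : 0 < β) {δ : ℝ} (hδ : 0 < δ)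
    (hδ2 : δ < 1 / 2) (μ : ℕ) :
    ENNReal.ofReal (minWeight α δ μ ^ 2) ≤ ENNReal.ofReal (2 ^ (2 * α + 1) * 2 ^ (2 * β)) *
      (ENNReal.ofReal (δ ^ (2 * α)) * ∫⁻ t in Set.Ioo δ 1, marchaudDensity α β μ t) := by
  have hN : (1 : ℝ) ≤ 2 ^ μ := one_le_pow₀ (by norm_num)
  have hN0 : (0 : ℝ) < 2 ^ μ := by positivity
  set s : ℝ := max δ (1 / (2 * 2 ^ μ)) with hs
  have hs0 : 0 < s := lt_max_of_lt_left hδ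
  have hs2 : 2 * s ≤ 1 := by
    have : s ≤ 1 / 2 := by
      refine max_le hδ2.le ?_
      exact one_div_le_one_div_of_le (by norm_num) (by linarith)
    linarith
  have hpt : ∀ t ∈ Set.Ioo s (2 * s),
      ENNReal.ofReal ((2 * s) ^ (-2 * α - 1) * (1 / 2) ^ (2 * β)) ≤ marchaudDensity α β μ t := by
    intro t ht
    have ht0 : 0 < t := hs0.trans ht.1
    refine ENNReal.ofReal_le_ofReal ?_
    rw [minWeight_sq ht0.le]
    refine mul_le_mul ?_ ?_ (by positivity) (by positivity)
    · exact Real.rpow_le_rpow_of_nonpos ht0 ht.2.le (by linarith)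
    · refine Real.rpow_le_rpow (by norm_num) (le_min (by norm_num) ?_) (by linarith)
      have : 1 / (2 * 2 ^ μ) ≤ t := (le_max_right _ _).trans ht.1.le
      rw [div_le_iff₀ (by positivity)] at this
      linarith
  have hJ : ENNReal.ofReal ((2 * s) ^ (-2 * α - 1) * (1 / 2) ^ (2 * β) * s) ≤
      ∫⁻ t in Set.Ioo δ 1, marchaudDensity α β μ t := by
    calc _ = ∫⁻ _ in Set.Ioo s (2 * s),
          ENNReal.ofReal ((2 * s) ^ (-2 * α - 1) * (1 / 2) ^ (2 * β)) := by
          rw [setLIntegral_const, Real.volume_Ioo, ← ENNReal.ofReal_mul (by positivity)]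
          ring_nf
      _ ≤ ∫⁻ t in Set.Ioo s (2 * s), marchaudDensity α β μ t :=
          setLIntegral_mono' measurableSet_Ioo hpt
      _ ≤ _ := lintegral_mono_set (Set.Ioo_subset_Ioo (le_max_left _ _) hs2)
  refine le_trans ?_ (mul_le_mul_right (mul_le_mul_right hJ _) _)
  rw [← ENNReal.ofReal_mul (by positivity), ← ENNReal.ofReal_mul (by positivity)]
  refine ENNReal.ofReal_le_ofReal ?_
  have e : 2 ^ (2 * α + 1) * 2 ^ (2 * β) * (δ ^ (2 * α) * ((2 * s) ^ (-2 * α - 1) *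
      (1 / 2) ^ (2 * β) * s)) = (δ / s) ^ (2 * α) := by
    have a1 : (1 / 2 : ℝ) ^ (2 * β) = (2 ^ (2 * β))⁻¹ := by
      rw [one_div, Real.inv_rpow (by norm_num)]
    have a2 : (2 * s) ^ (-2 * α - 1) = (2 ^ (2 * α + 1))⁻¹ * (s ^ (2 * α) * s)⁻¹ := by
      rw [show -2 * α - 1 = -(2 * α + 1) by ring, Real.rpow_neg (by positivity),
        Real.mul_rpow (by norm_num) hs0.le, mul_inv, Real.rpow_add_one hs0.ne']
    rw [a1, a2, Real.div_rpow hδ.le hs0.le]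
    field_simp
  rw [e, minWeight_sq hδ.le]
  refine Real.rpow_le_rpow (by positivity) ?_ (by linarith)
  rw [le_div_iff₀ hs0, hs]
  rcases le_total δ (1 / (2 * 2 ^ μ)) with h | h
  · rw [max_eq_right h]
    calc min 1 (2 ^ μ * δ) * (1 / (2 * 2 ^ μ)) ≤ 2 ^ μ * δ * (1 / (2 * 2 ^ μ)) :=
          mul_le_mul_of_nonneg_right (min_le_right _ _) (by positivity)
      _ = δ / 2 := by field_simp
      _ ≤ δ := by linarith
  · rw [max_eq_left h]
    exact mul_le_of_le_one_left hδ.le (min_le_left _ _)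

theorem lintegral_lacSum_eq (lam : ℕ → ℕ → ℝ) (α₁ α₂ β₁ β₂ : ℝ) {δ₁ δ₂ : ℝ} (hδ₁ : 0 < δ₁)
    (hδ₂ : 0 < δ₂) :
    ∫⁻ t₁ in Set.Ioo δ₁ 1, ∫⁻ t₂ in Set.Ioo δ₂ 1,
      ENNReal.ofReal ((t₁ ^ (-α₁) * t₂ ^ (-α₂)) ^ (2 : ℝ) / (t₁ * t₂)) *
        lacSum lam (minWeight β₁ t₁) (minWeight β₂ t₂) =
      ∑' i : ℕ × ℕ, ENNReal.ofReal (lam i.1 i.2 ^ 2) *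
        ((∫⁻ t in Set.Ioo δ₁ 1, marchaudDensity α₁ β₁ i.1 t) *
          ∫⁻ t in Set.Ioo δ₂ 1, marchaudDensity α₂ β₂ i.2 t) := by
  have hpow : ∀ (α : ℝ) {t : ℝ}, 0 < t → t ^ (-2 * α - 1) = (t ^ (-α)) ^ 2 / t := by
    intro α t ht
    rw [Real.rpow_sub_one ht.ne', ← Real.rpow_natCast, ← Real.rpow_mul ht.le]
    ring_nf
  have e : ∀ t₁ ∈ Set.Ioo δ₁ 1, ∀ t₂ ∈ Set.Ioo δ₂ 1,
      ENNReal.ofReal ((t₁ ^ (-α₁) * t₂ ^ (-α₂)) ^ (2 : ℝ) / (t₁ * t₂)) *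
        lacSum lam (minWeight β₁ t₁) (minWeight β₂ t₂) =
      ∑' i : ℕ × ℕ, ENNReal.ofReal (lam i.1 i.2 ^ 2) * marchaudDensity α₁ β₁ i.1 t₁ *
        marchaudDensity α₂ β₂ i.2 t₂ := by
    intro t₁ ht₁ t₂ ht₂
    have h₁ := hδ₁.trans ht₁.1
    have h₂ := hδ₂.trans ht₂.1
    rw [lacSum, ← ENNReal.tsum_mul_left]
    refine tsum_congr fun i => ?_
    rw [marchaudDensity, marchaudDensity, ← ENNReal.ofReal_mul (by positivity),
      ← ENNReal.ofReal_mul (by positivity), ← ENNReal.ofReal_mul (by positivity), hpow α₁ h₁,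
      hpow α₂ h₂, Real.rpow_two]
    congr 1
    field_simp
  calc _ = ∫⁻ t₁ in Set.Ioo δ₁ 1, ∑' i : ℕ × ℕ, ENNReal.ofReal (lam i.1 i.2 ^ 2) *
        marchaudDensity α₁ β₁ i.1 t₁ * ∫⁻ t in Set.Ioo δ₂ 1, marchaudDensity α₂ β₂ i.2 t := by
        refine setLIntegral_congr_fun measurableSet_Ioo fun t₁ ht₁ => ?_
        rw [setLIntegral_congr_fun measurableSet_Ioo (e t₁ ht₁), lintegral_tsum fun i =>
          ((measurable_marchaudDensity _ _ _).const_mul _).aemeasurable]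
        exact tsum_congr fun i => lintegral_const_mul _ (measurable_marchaudDensity _ _ _)
    _ = _ := by
        rw [lintegral_tsum fun i =>
          (((measurable_marchaudDensity _ _ _).const_mul _).mul_const _).aemeasurable]
        refine tsum_congr fun i => ?_
        rw [lintegral_mul_const _ ((measurable_marchaudDensity _ _ _).const_mul _),
          lintegral_const_mul _ (measurable_marchaudDensity _ _ _), mul_assoc]

theorem exists_lintegral_lacSum_equiv {α₁ α₂ β₁ β₂ : ℝ} (hα₁ : 0 < α₁) (hα₂ : 0 < α₂)
    (hαβ₁ : α₁ < β₁) (hαβ₂ : α₂ < β₂) :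
    ∃ C : ℝ, 0 < C ∧ ∀ (lam : ℕ → ℕ → ℝ) (δ₁ δ₂ : ℝ),
      δ₁ ∈ Set.Ioo (0 : ℝ) (1 / 2) → δ₂ ∈ Set.Ioo (0 : ℝ) (1 / 2) →
      ENNReal.ofReal (δ₁ ^ α₁ * δ₂ ^ α₂) ^ 2 * (∫⁻ t₁ in Set.Ioo δ₁ 1, ∫⁻ t₂ in Set.Ioo δ₂ 1,
        ENNReal.ofReal ((t₁ ^ (-α₁) * t₂ ^ (-α₂)) ^ (2 : ℝ) / (t₁ * t₂)) *
          lacSum lam (minWeight β₁ t₁) (minWeight β₂ t₂)) ≤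
        ENNReal.ofReal C * lacSum lam (minWeight α₁ δ₁) (minWeight α₂ δ₂) ∧
      lacSum lam (minWeight α₁ δ₁) (minWeight α₂ δ₂) ≤
        ENNReal.ofReal C * (ENNReal.ofReal (δ₁ ^ α₁ * δ₂ ^ α₂) ^ 2 *
          ∫⁻ t₁ in Set.Ioo δ₁ 1, ∫⁻ t₂ in Set.Ioo δ₂ 1,
            ENNReal.ofReal ((t₁ ^ (-α₁) * t₂ ^ (-α₂)) ^ (2 : ℝ) / (t₁ * t₂)) *
              lacSum lam (minWeight β₁ t₁) (minWeight β₂ t₂)) := by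
  set K₁ := 1 / (2 * α₁) + 1 / (2 * (β₁ - α₁))
  set K₂ := 1 / (2 * α₂) + 1 / (2 * (β₂ - α₂))
  set M₁ : ℝ := 2 ^ (2 * α₁ + 1) * 2 ^ (2 * β₁)
  set M₂ : ℝ := 2 ^ (2 * α₂ + 1) * 2 ^ (2 * β₂)
  have hs₁ : 0 < β₁ - α₁ := by linarith
  have hs₂ : 0 < β₂ - α₂ := by linarith
  have hK₁ : 0 < K₁ := by positivity
  have hK₂ : 0 < K₂ := by positivity
  have hM₁ : 0 < M₁ := by positivity
  have hM₂ : 0 < M₂ := by positivity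
  refine ⟨max (K₁ * K₂) (M₁ * M₂), lt_max_of_lt_left (by positivity),
    fun lam δ₁ δ₂ ⟨hδ₁, hδ₁'⟩ ⟨hδ₂, hδ₂'⟩ => ?_⟩
  rw [lintegral_lacSum_eq lam α₁ α₂ β₁ β₂ hδ₁ hδ₂]
  have hsq : ∀ (α : ℝ) {δ : ℝ}, 0 < δ → (δ ^ α) ^ 2 = δ ^ (2 * α) := by
    intro α δ hδ
    rw [← Real.rpow_natCast, ← Real.rpow_mul hδ.le, mul_comm α]
    norm_num
  have hw : ENNReal.ofReal (δ₁ ^ α₁ * δ₂ ^ α₂) ^ 2 =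
      ENNReal.ofReal (δ₁ ^ (2 * α₁)) * ENNReal.ofReal (δ₂ ^ (2 * α₂)) := by
    rw [← ENNReal.ofReal_pow (by positivity), mul_pow, hsq _ hδ₁, hsq _ hδ₂,
      ENNReal.ofReal_mul (by positivity)]
  have hterm : ∀ i : ℕ × ℕ,
      ENNReal.ofReal ((lam i.1 i.2 * minWeight α₁ δ₁ i.1 * minWeight α₂ δ₂ i.2) ^ 2) =
      ENNReal.ofReal (lam i.1 i.2 ^ 2) * (ENNReal.ofReal (minWeight α₁ δ₁ i.1 ^ 2) *
        ENNReal.ofReal (minWeight α₂ δ₂ i.2 ^ 2)) := by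
    intro i
    rw [← ENNReal.ofReal_mul (by positivity), ← ENNReal.ofReal_mul (by positivity)]
    ring_nf
  rw [hw, lacSum, ← ENNReal.tsum_mul_left, ← ENNReal.tsum_mul_left, ← ENNReal.tsum_mul_left]
  constructor
  · refine ENNReal.tsum_le_tsum fun i => ?_
    have u₁ : _ ≤ ENNReal.ofReal (K₁ * _) := lintegral_marchaudDensity_le hα₁ hαβ₁ hδ₁ i.1
    have u₂ : _ ≤ ENNReal.ofReal (K₂ * _) := lintegral_marchaudDensity_le hα₂ hαβ₂ hδ₂ i.2
    rw [ENNReal.ofReal_mul hK₁.le] at u₁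
    rw [ENNReal.ofReal_mul hK₂.le] at u₂
    rw [hterm]
    calc _ = ENNReal.ofReal (lam i.1 i.2 ^ 2) *
          ((ENNReal.ofReal (δ₁ ^ (2 * α₁)) * ∫⁻ t in Set.Ioo δ₁ 1, marchaudDensity α₁ β₁ i.1 t) *
          (ENNReal.ofReal (δ₂ ^ (2 * α₂)) * ∫⁻ t in Set.Ioo δ₂ 1, marchaudDensity α₂ β₂ i.2 t)) :=
          by ring
      _ ≤ ENNReal.ofReal (lam i.1 i.2 ^ 2) * (_ * _) :=
          mul_le_mul_right (mul_le_mul' u₁ u₂) _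
      _ = ENNReal.ofReal (K₁ * K₂) * (ENNReal.ofReal (lam i.1 i.2 ^ 2) *
          (ENNReal.ofReal (minWeight α₁ δ₁ i.1 ^ 2) *
            ENNReal.ofReal (minWeight α₂ δ₂ i.2 ^ 2))) := by
          rw [ENNReal.ofReal_mul hK₁.le]
          ring
      _ ≤ _ := mul_le_mul_left (ENNReal.ofReal_le_ofReal (le_max_left _ _)) _
  · refine ENNReal.tsum_le_tsum fun i => ?_
    have u₁ : _ ≤ ENNReal.ofReal M₁ * _ :=
      le_lintegral_marchaudDensity hα₁ (hα₁.trans hαβ₁) hδ₁ hδ₁' i.1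
    have u₂ : _ ≤ ENNReal.ofReal M₂ * _ :=
      le_lintegral_marchaudDensity hα₂ (hα₂.trans hαβ₂) hδ₂ hδ₂' i.2
    rw [hterm]
    calc _ ≤ ENNReal.ofReal (lam i.1 i.2 ^ 2) * (_ * _) :=
          mul_le_mul_right (mul_le_mul' u₁ u₂) _
      _ = ENNReal.ofReal (M₁ * M₂) * (ENNReal.ofReal (δ₁ ^ (2 * α₁)) *
          ENNReal.ofReal (δ₂ ^ (2 * α₂)) * (ENNReal.ofReal (lam i.1 i.2 ^ 2) *
          ((∫⁻ t in Set.Ioo δ₁ 1, marchaudDensity α₁ β₁ i.1 t) *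
            ∫⁻ t in Set.Ioo δ₂ 1, marchaudDensity α₂ β₂ i.2 t))) := by
          rw [ENNReal.ofReal_mul hM₁.le]
          ring
      _ ≤ _ := mul_le_mul_left (ENNReal.ofReal_le_ofReal (le_max_right _ _)) _

theorem ENNReal.le_ofReal_sqrt_mul_of_sq_le {C : ℝ} (hC : 0 ≤ C) {X Y : ℝ≥0∞}
    (h : X ^ 2 ≤ ENNReal.ofReal C * Y ^ 2) : X ≤ ENNReal.ofReal √C * Y := by
  refine (ENNReal.pow_le_pow_left_iff two_ne_zero).1 ?_
  rwa [mul_pow, ← ENNReal.ofReal_pow (Real.sqrt_nonneg _), Real.sq_sqrt hC]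

theorem marchaudInt_two_sq (p α₁ α₂ β₁ β₂ δ₁ δ₂ : ℝ) (f : ℝ → ℝ → ℝ) :
    marchaudInt p α₁ α₂ β₁ β₂ δ₁ δ₂ 2 f ^ 2 = ENNReal.ofReal (δ₁ ^ α₁ * δ₂ ^ α₂) ^ 2 *
      ∫⁻ t₁ in Set.Ioo δ₁ 1, ∫⁻ t₂ in Set.Ioo δ₂ 1,
        ENNReal.ofReal ((t₁ ^ (-α₁) * t₂ ^ (-α₂)) ^ (2 : ℝ) / (t₁ * t₂)) *
          mixedMod p β₁ β₂ t₁ t₂ f ^ 2 := by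
  rw [marchaudInt, mul_pow, ← ENNReal.rpow_natCast (_ ^ (1 / (2 : ℝ))), ← ENNReal.rpow_mul]
  norm_num [ENNReal.rpow_two]

theorem setLIntegral_setLIntegral_le_const_mul {s t : Set ℝ} (hs : MeasurableSet s)
    (ht : MeasurableSet t) {C : ℝ≥0∞} (hC : C ≠ ⊤) {w F G : ℝ → ℝ → ℝ≥0∞}
    (h : ∀ x ∈ s, ∀ y ∈ t, F x y ≤ C * G x y) :
    ∫⁻ x in s, ∫⁻ y in t, w x y * F x y ≤ C * ∫⁻ x in s, ∫⁻ y in t, w x y * G x y := by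
  rw [← lintegral_const_mul' _ _ hC]
  refine setLIntegral_mono' hs fun x hx => ?_
  rw [← lintegral_const_mul' _ _ hC]
  refine setLIntegral_mono' ht fun y hy => ?_
  rw [mul_left_comm]
  exact mul_le_mul_right (h x hx y hy) _

/-- For `f ∈ Λ_p`, the mixed moduli of smoothness of different orders are related
by an equivalence with exponent `2` (Theorem 10.3). -/
theorem sharp_marchaud_Lambda (p α₁ α₂ β₁ β₂ : ℝ) (hp : 1 < p)
    (hα₁ : 0 < α₁) (hα₂ : 0 < α₂) (hαβ₁ : α₁ < β₁) (hαβ₂ : α₂ < β₂) :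
    ∃ C : ℝ, 0 < C ∧ ∀ (f : ℝ → ℝ → ℝ) (lam : ℕ → ℕ → ℝ) (δ₁ δ₂ : ℝ),
      InLambdaClass p f lam → δ₁ ∈ Set.Ioo (0:ℝ) (1/2) → δ₂ ∈ Set.Ioo (0:ℝ) (1/2) →
      mixedMod p α₁ α₂ δ₁ δ₂ f ≤
          ENNReal.ofReal C * marchaudInt p α₁ α₂ β₁ β₂ δ₁ δ₂ 2 f ∧
      marchaudInt p α₁ α₂ β₁ β₂ δ₁ δ₂ 2 f ≤
          ENNReal.ofReal C * mixedMod p α₁ α₂ δ₁ δ₂ f := by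
  obtain ⟨A, hA, hA'⟩ := exists_mixedMod_equiv hp hα₁ hα₂
  obtain ⟨B, hB, hB'⟩ := exists_mixedMod_equiv hp (hα₁.trans hαβ₁) (hα₂.trans hαβ₂)
  obtain ⟨K, hK, hK'⟩ := exists_lintegral_lacSum_equiv hα₁ hα₂ hαβ₁ hαβ₂
  refine ⟨√(A * K * B), by positivity, fun f lam δ₁ δ₂ hf hδ₁ hδ₂ => ?_⟩
  have hsub : ∀ {δ : ℝ}, δ ∈ Set.Ioo (0 : ℝ) (1 / 2) → Set.Ioo δ 1 ⊆ Set.Ioo 0 1 :=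
    fun h => Set.Ioo_subset_Ioo_left h.1.le
  obtain ⟨a, a'⟩ := hA' f lam hf δ₁ δ₂ ⟨hδ₁.1, hδ₁.2.trans (by norm_num)⟩
    ⟨hδ₂.1, hδ₂.2.trans (by norm_num)⟩
  obtain ⟨k, k'⟩ := hK' lam δ₁ δ₂ hδ₁ hδ₂
  have b := fun t₁ (h₁ : t₁ ∈ Set.Ioo δ₁ 1) t₂ (h₂ : t₂ ∈ Set.Ioo δ₂ 1) =>
    hB' f lam hf t₁ t₂ (hsub hδ₁ h₁) (hsub hδ₂ h₂)
  have hI := setLIntegral_setLIntegral_le_const_mul measurableSet_Ioo measurableSet_Ioo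
    ENNReal.ofReal_ne_top (w := fun t₁ t₂ =>
      ENNReal.ofReal ((t₁ ^ (-α₁) * t₂ ^ (-α₂)) ^ (2 : ℝ) / (t₁ * t₂)))
    fun t₁ h₁ t₂ h₂ => (b t₁ h₁ t₂ h₂).1
  have hI' := setLIntegral_setLIntegral_le_const_mul measurableSet_Ioo measurableSet_Ioo
    ENNReal.ofReal_ne_top (w := fun t₁ t₂ =>
      ENNReal.ofReal ((t₁ ^ (-α₁) * t₂ ^ (-α₂)) ^ (2 : ℝ) / (t₁ * t₂)))
    fun t₁ h₁ t₂ h₂ => (b t₁ h₁ t₂ h₂).2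
  have hC : ENNReal.ofReal (A * K * B) =
      ENNReal.ofReal A * ENNReal.ofReal K * ENNReal.ofReal B := by
    rw [ENNReal.ofReal_mul (by positivity), ENNReal.ofReal_mul hA.le]
  constructor <;> refine ENNReal.le_ofReal_sqrt_mul_of_sq_le (by positivity) ?_
  · rw [marchaudInt_two_sq, hC]
    refine a.trans ((mul_le_mul_right (k'.trans (mul_le_mul_right
      (mul_le_mul_right hI' _) _)) _).trans (le_of_eq ?_))
    ring
  · rw [marchaudInt_two_sq, hC]
    refine (mul_le_mul_right hI _).trans ?_
    rw [mul_left_comm]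
    refine (mul_le_mul_right (k.trans (mul_le_mul_right a' _)) _).trans (le_of_eq ?_)
    ring

end
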